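/- Let U⁺ be the subalgebra of U_q generated by {E_i : i ∈ Î}, and let x ∈ U⁺ be a K-linear combination of products E_{j_1}⋯E_{j_m} with m ≥ 1 (i.e. x has zero constant term). If x F_k = F_k x for all k ∈ Î, then x = 0. -/

import Mathlib

open scoped BigOperators TensorProduct

noncomputable section

/-- The base field `K = ℚ(q)` of rational functions over `ℚ`. -/
abbrev Kq : Type := RatFunc ℚ

/-- The element `q ∈ ℚ(q)`. -/
def qvar : Kq := RatFunc.X

/-- Generators of the quantum affine algebra: `E_i`, `F_i`, `K_i`, `K_i⁻¹`, `γ^{1/2}`,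
`γ^{-1/2}`. -/
inductive Gen (n : ℕ) : Type
  | E : Fin n → Gen n
  | F : Fin n → Gen n
  | K : Fin n → Gen n
  | Kinv : Fin n → Gen n
  | g : Gen n
  | ginv : Gen n

variable {n : ℕ}

/-- The free algebra on the generators. -/
abbrev FA (n : ℕ) : Type := FreeAlgebra Kq (Gen n)

/-- Inclusion of the generators into the free algebra. -/
def ι : Gen n → FA n := FreeAlgebra.ι Kq

/-- `q_i = q^{d_i}`. -/
def qi (d : Fin n → ℕ) (i : Fin n) : Kq := qvar ^ (d i)

/-- The quantum integer `[m]_i = (q_i^m - q_i^{-m})/(q_i - q_i⁻¹)`. -/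
def qint (d : Fin n → ℕ) (i : Fin n) (m : ℤ) : Kq :=
  (qi d i ^ m - qi d i ^ (-m)) / (qi d i - (qi d i)⁻¹)

/-- The quantum factorial `[m]_i!`. -/
def qfact (d : Fin n → ℕ) (i : Fin n) : ℕ → Kq
  | 0 => 1
  | m + 1 => qfact d i m * qint d i (m + 1)

/-- The quantum binomial coefficient `[m choose s]_i`. -/
def qbinom (d : Fin n → ℕ) (i : Fin n) (m s : ℕ) : Kq :=
  qfact d i m / (qfact d i s * qfact d i (m - s))

/-- The quantum Serre element `∑_{s=0}^{1-a_{ij}} (-1)^s [1-a_{ij} choose s]_i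
E_i^{1-a_{ij}-s} E_j E_i^s` in the free algebra. -/
def serreE (a : Fin n → Fin n → ℤ) (d : Fin n → ℕ) (i j : Fin n) : FA n :=
  ∑ s ∈ Finset.range ((1 - a i j).toNat + 1),
    ((-1 : Kq) ^ s * qbinom d i (1 - a i j).toNat s) •
      (ι (Gen.E i) ^ ((1 - a i j).toNat - s) * ι (Gen.E j) * ι (Gen.E i) ^ s)

/-- The quantum Serre element in the `F`'s. -/
def serreF (a : Fin n → Fin n → ℤ) (d : Fin n → ℕ) (i j : Fin n) : FA n :=
  ∑ s ∈ Finset.range ((1 - a i j).toNat + 1),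
    ((-1 : Kq) ^ s * qbinom d i (1 - a i j).toNat s) •
      (ι (Gen.F i) ^ ((1 - a i j).toNat - s) * ι (Gen.F j) * ι (Gen.F i) ^ s)

/-- The defining relations of the quantum affine algebra `U_q`. -/
inductive QRel (a : Fin n → Fin n → ℤ) (d r : Fin n → ℕ) : FA n → FA n → Prop
  | KKinv (i : Fin n) : QRel a d r (ι (Gen.K i) * ι (Gen.Kinv i)) 1
  | KinvK (i : Fin n) : QRel a d r (ι (Gen.Kinv i) * ι (Gen.K i)) 1
  | gginv : QRel a d r (ι Gen.g * ι Gen.ginv) 1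
  | ginvg : QRel a d r (ι Gen.ginv * ι Gen.g) 1
  | gcomm (x : Gen n) : QRel a d r (ι Gen.g * ι x) (ι x * ι Gen.g)
  | gsq : QRel a d r (ι Gen.g * ι Gen.g)
      (((List.finRange n).map fun i => ι (Gen.K i) ^ r i).prod)
  | KK (i j : Fin n) : QRel a d r (ι (Gen.K i) * ι (Gen.K j)) (ι (Gen.K j) * ι (Gen.K i))
  | KE (i j : Fin n) : QRel a d r (ι (Gen.K i) * ι (Gen.E j))
      ((qi d i ^ (a i j)) • (ι (Gen.E j) * ι (Gen.K i)))
  | KF (i j : Fin n) : QRel a d r (ι (Gen.K i) * ι (Gen.F j))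
      ((qi d i ^ (-(a i j))) • (ι (Gen.F j) * ι (Gen.K i)))
  | EF (i j : Fin n) : QRel a d r (ι (Gen.E i) * ι (Gen.F j) - ι (Gen.F j) * ι (Gen.E i))
      (if i = j then ((qi d i - (qi d i)⁻¹)⁻¹) • (ι (Gen.K i) - ι (Gen.Kinv i)) else 0)
  | serreEE (i j : Fin n) (h : i ≠ j) : QRel a d r (serreE a d i j) 0
  | serreFF (i j : Fin n) (h : i ≠ j) : QRel a d r (serreF a d i j) 0

/-- The quantum affine algebra `U_q`, presented by the generators and relations above. -/
abbrev Uq (a : Fin n → Fin n → ℤ) (d r : Fin n → ℕ) : Type := RingQuot (QRel a d r)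

/-- The images of the generators in `U_q`. -/
def gen (a : Fin n → Fin n → ℤ) (d r : Fin n → ℕ) (x : Gen n) : Uq a d r :=
  RingQuot.mkAlgHom Kq (QRel a d r) (ι x)

/-- The hypotheses on the Cartan data: `A = (a_{ij})` is a symmetrizable generalized Cartan
matrix with symmetrizing positive integers `d_i`, and the positive integers `r_i` satisfy
`∑_i r_i d_i a_{ij} = 0` for all `j`. -/
structure CartanData (n : ℕ) (a : Fin n → Fin n → ℤ) (d r : Fin n → ℕ) : Prop where
  diag : ∀ i, a i i = 2
  offdiag : ∀ i j, i ≠ j → a i j ≤ 0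
  zero_iff : ∀ i j, a i j = 0 ↔ a j i = 0
  symmetrizable : ∀ i j, (d i : ℤ) * a i j = (d j : ℤ) * a j i
  d_pos : ∀ i, 0 < d i
  r_pos : ∀ i, 0 < r i
  null : ∀ j, ∑ i, (r i : ℤ) * (d i : ℤ) * a i j = 0

/-- The pairing `(β, α_i) = ∑_j β_j d_i a_{ij}` for `β ∈ ℤ^Î`. -/
def wtpair (a : Fin n → Fin n → ℤ) (d : Fin n → ℕ) (β : Fin n → ℤ) (i : Fin n) : ℤ :=
  ∑ j, β j * (d i : ℤ) * a i j

/-- `x ∈ U_q` has weight `β` if `K_j x K_j⁻¹ = q^{(β,α_j)} x` for all `j`, phrased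
multiplicatively as `K_j x = q^{(β,α_j)} (x K_j)`. -/
def HasWeight (a : Fin n → Fin n → ℤ) (d r : Fin n → ℕ) (β : Fin n → ℤ)
    (x : Uq a d r) : Prop :=
  ∀ j, gen a d r (Gen.K j) * x = (qvar ^ wtpair a d β j) • (x * gen a d r (Gen.K j))

/-- The subalgebra `U⁺` of `U_q` generated by the `E_i`. -/
def Uplus (a : Fin n → Fin n → ℤ) (d r : Fin n → ℕ) : Subalgebra Kq (Uq a d r) :=
  Algebra.adjoin Kq (Set.range fun i => gen a d r (Gen.E i))

lemma E_mem_Uplus (a : Fin n → Fin n → ℤ) (d r : Fin n → ℕ) (j : Fin n) :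
    gen a d r (Gen.E j) ∈ Uplus a d r :=
  Algebra.subset_adjoin ⟨j, rfl⟩

/-- The generator `E_j` as an element of `U⁺`. -/
def Eplus (a : Fin n → Fin n → ℤ) (d r : Fin n → ℕ) (j : Fin n) : Uplus a d r :=
  ⟨gen a d r (Gen.E j), E_mem_Uplus a d r j⟩

/-- The defining properties of the twisted derivations `r_i : U⁺ → U⁺`:
`r_i(1) = 0`, `r_i(E_j) = δ_{ij}`, and the twisted Leibniz rule
`r_i(xy) = q^{(|y|,α_i)} r_i(x) y + x r_i(y)` for weight-homogeneous `y`. -/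
def DerProp (a : Fin n → Fin n → ℤ) (d r : Fin n → ℕ)
    (ri : Fin n → ((Uplus a d r) →ₗ[Kq] (Uplus a d r))) : Prop :=
  ∀ i : Fin n,
    ri i 1 = 0 ∧
    (∀ j, ri i (Eplus a d r j) = if i = j then 1 else 0) ∧
    (∀ (x y : Uplus a d r) (β : Fin n → ℤ), HasWeight a d r β (y : Uq a d r) →
      ri i (x * y) = (qvar ^ wtpair a d β i) • (ri i x * y) + x * ri i y)

/-- The span of the nonempty monomials `E_{j_1} ⋯ E_{j_m}`, `m ≥ 1` (elements of `U⁺`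
with zero constant term). -/
def AugSpan (a : Fin n → Fin n → ℤ) (d r : Fin n → ℕ) : Submodule Kq (Uq a d r) :=
  Submodule.span Kq
    {z | ∃ l : List (Fin n), l ≠ [] ∧ z = (l.map fun j => gen a d r (Gen.E j)).prod}

/-- The combination `∑_{s ≤ N} c_s x^{N-s} y x^s`. -/
def serreComb {K A : Type*} [CommSemiring K] [Semiring A] [Algebra K A]
    (c : ℕ → K) (N : ℕ) (x y : A) : A :=
  ∑ s ∈ Finset.range (N + 1), c s • (x ^ (N - s) * y * x ^ s)

section SerreComb

variable {K A B : Type*} [Field K] [Ring A] [Algebra K A] [Ring B] [Algebra K B]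

lemma map_serreComb (f : A →ₐ[K] B) (c : ℕ → K) (N : ℕ) (x y : A) :
    f (serreComb c N x y) = serreComb c N (f x) (f y) := by
  simp [serreComb]

lemma serreComb_smul_smul (c : ℕ → K) (N : ℕ) (u v : K) (x y : A) :
    serreComb c N (u • x) (v • y) = (u ^ N * v) • serreComb c N x y := by
  simp only [serreComb, Finset.smul_sum]
  refine Finset.sum_congr rfl fun s hs => ?_
  have hs' : N - s + s = N := Nat.sub_add_cancel (Finset.mem_range_succ_iff.mp hs)
  simp only [smul_pow, smul_mul_assoc, mul_smul_comm, smul_smul]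
  congr 1
  rw [← hs', pow_add, hs']
  ring

lemma unop_serreComb_op {c : ℕ → K} {N : ℕ}
    (hc : ∀ s ≤ N, c (N - s) = (-1) ^ N * c s) (x y : A) :
    (serreComb c N (MulOpposite.op x) (MulOpposite.op y)).unop =
      (-1 : K) ^ N • serreComb c N x y := by
  have h : (serreComb c N (MulOpposite.op x) (MulOpposite.op y)).unop =
      ∑ s ∈ Finset.range (N + 1), c s • (x ^ s * y * x ^ (N - s)) := by
    simp [serreComb, mul_assoc]
  rw [h, ← Finset.sum_range_reflect, serreComb, Finset.smul_sum]
  refine Finset.sum_congr rfl fun s hs => ?_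
  have hs' : s ≤ N := Finset.mem_range_succ_iff.mp hs
  rw [show N + 1 - 1 - s = N - s by omega, show N - (N - s) = s by omega, hc s hs', smul_smul]

lemma pow_mul_eq_of_skew {x f k k' : A} {u v : K} (hx : x * f = f * x + k + k')
    (hk : k * x = u • (x * k)) (hk' : k' * x = v • (x * k')) (m : ℕ) :
    x ^ m * f = f * x ^ m + (∑ t ∈ Finset.range m, u ^ t) • (x ^ (m - 1) * k) +
      (∑ t ∈ Finset.range m, v ^ t) • (x ^ (m - 1) * k') := by
  induction m with
  | zero => simp
  | succ m ih =>
    have aux : ∀ (w : K) (l : A), l * x = w • (x * l) →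
        (∑ t ∈ Finset.range m, w ^ t) • (x ^ (m - 1) * l) * x + x ^ m * l =
          (∑ t ∈ Finset.range (m + 1), w ^ t) • (x ^ m * l) := by
      intro w l hl
      rcases m with _ | m
      · simp
      · rw [Finset.sum_range_succ' _ (m + 1), smul_mul_assoc, mul_assoc, Nat.add_sub_cancel, hl,
          mul_smul_comm, ← mul_assoc, ← pow_succ, smul_smul, add_smul, Finset.sum_mul]
        simp [pow_succ]
    have h1 : x ^ (m + 1) * f = x ^ m * f * x + x ^ m * k + x ^ m * k' := by
      rw [pow_succ, mul_assoc, hx]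
      noncomm_ring
    rw [h1, ih, Nat.add_sub_cancel, ← aux u k hk, ← aux v k' hk', pow_succ]
    noncomm_ring

lemma mul_pow_eq_of_skew {x k : A} {u : K} (hk : k * x = u • (x * k)) (m : ℕ) :
    k * x ^ m = u ^ m • (x ^ m * k) := by
  induction m with
  | zero => simp
  | succ m ih =>
    rw [pow_succ, ← mul_assoc, ih, smul_mul_assoc, mul_assoc, hk, mul_smul_comm, smul_smul,
      ← pow_succ, mul_assoc]

/-- Serre combinations commute with `f` when `[x, f] = k + k'` and `[y, f] = 0`. -/
lemma serreComb_mul_comm_of_skew_left {c : ℕ → K} {N : ℕ} {x y f k k' : A} {u v u' v' : K}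
    (hx : x * f = f * x + k + k') (hy : y * f = f * y)
    (hk : k * x = u • (x * k)) (hk' : k' * x = v • (x * k'))
    (hky : k * y = u' • (y * k)) (hky' : k' * y = v' • (y * k'))
    (hu : ∀ t < N, c (t + 1) * ∑ s ∈ Finset.range (t + 1), u ^ s +
      c t * (u' * u ^ t) * ∑ s ∈ Finset.range (N - t), u ^ s = 0)
    (hv : ∀ t < N, c (t + 1) * ∑ s ∈ Finset.range (t + 1), v ^ s +
      c t * (v' * v ^ t) * ∑ s ∈ Finset.range (N - t), v ^ s = 0) :
    serreComb c N x y * f = f * serreComb c N x y := by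
  have part : ∀ (w w' : K) (l : A), l * x = w • (x * l) → l * y = w' • (y * l) →
      (∀ t < N, c (t + 1) * ∑ s ∈ Finset.range (t + 1), w ^ s +
        c t * (w' * w ^ t) * ∑ s ∈ Finset.range (N - t), w ^ s = 0) →
      ∑ s ∈ Finset.range (N + 1), c s • (x ^ (N - s) * y *
          ((∑ t ∈ Finset.range s, w ^ t) • (x ^ (s - 1) * l)) +
        (∑ t ∈ Finset.range (N - s), w ^ t) • (x ^ (N - s - 1) * l) * y * x ^ s) = 0 := by
    intro w w' l hl hly hw
    simp only [smul_add, Finset.sum_add_distrib]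
    rw [Finset.sum_range_succ', Finset.sum_range_succ _ N]
    simp only [Finset.range_zero, Finset.sum_empty, zero_smul, mul_zero, smul_zero, add_zero,
      Nat.sub_self, zero_mul]
    rw [← Finset.sum_add_distrib]
    refine Finset.sum_eq_zero fun t ht => ?_
    have e1 : x ^ (N - t - 1) * l * y * x ^ t =
        (w' * w ^ t) • (x ^ (N - t - 1) * y * x ^ t * l) := by
      rw [mul_assoc _ l y, hly, mul_smul_comm, smul_mul_assoc, ← mul_assoc, mul_assoc _ l,
        mul_pow_eq_of_skew hl, mul_smul_comm, smul_smul, ← mul_assoc]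
    rw [smul_mul_assoc, smul_mul_assoc, e1, Nat.add_sub_cancel, ← Nat.sub_sub, mul_smul_comm,
      ← mul_assoc, smul_smul, smul_smul, smul_smul, ← add_smul]
    convert zero_smul K _
    rw [← hw t (Finset.mem_range.mp ht)]
    ring
  rw [serreComb, Finset.sum_mul, Finset.mul_sum, ← sub_eq_zero, ← Finset.sum_sub_distrib]
  refine Eq.trans ?_ ((congrArg₂ (· + ·) (part u u' k hk hky hu)
    (part v v' k' hk' hky' hv)).trans (add_zero 0))
  rw [← Finset.sum_add_distrib]
  refine Finset.sum_congr rfl fun s _ => ?_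
  rw [smul_mul_assoc, mul_smul_comm, ← smul_sub, ← smul_add]
  congr 1
  have h1 := pow_mul_eq_of_skew hx hk hk' s
  have h2 := pow_mul_eq_of_skew hx hk hk' (N - s)
  rw [mul_assoc _ _ f, h1]
  have h3 : x ^ (N - s) * y * (f * x ^ s) = x ^ (N - s) * f * y * x ^ s := by
    rw [mul_assoc _ y, ← mul_assoc y f, hy]; noncomm_ring
  rw [mul_add, mul_add, h3, h2]
  noncomm_ring

/-- Serre combinations commute with `f` when `[x, f] = 0` and `[y, f] = k + k'`. -/
lemma serreComb_mul_comm_of_skew_right {c : ℕ → K} {N : ℕ} {x y f k k' : A} {u v : K}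
    (hx : x * f = f * x) (hy : y * f = f * y + k + k')
    (hk : k * x = u • (x * k)) (hk' : k' * x = v • (x * k'))
    (hu : ∑ s ∈ Finset.range (N + 1), c s * u ^ s = 0)
    (hv : ∑ s ∈ Finset.range (N + 1), c s * v ^ s = 0) :
    serreComb c N x y * f = f * serreComb c N x y := by
  have hxm : ∀ m, x ^ m * f = f * x ^ m := fun m => (Commute.pow_left hx m).eq
  have key : serreComb c N x y * f = f * serreComb c N x y +
      (∑ s ∈ Finset.range (N + 1), c s * u ^ s) • (x ^ N * k) +
      (∑ s ∈ Finset.range (N + 1), c s * v ^ s) • (x ^ N * k') := by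
    rw [serreComb, Finset.sum_mul, Finset.mul_sum, Finset.sum_smul, Finset.sum_smul,
      ← Finset.sum_add_distrib, ← Finset.sum_add_distrib]
    refine Finset.sum_congr rfl fun s hs => ?_
    have hs' : x ^ (N - s) * x ^ s = x ^ N := by
      rw [← pow_add, Nat.sub_add_cancel (Finset.mem_range_succ_iff.mp hs)]
    rw [smul_mul_assoc, mul_smul_comm, mul_smul, mul_smul, ← smul_add, ← smul_add]
    congr 1
    rw [mul_assoc _ _ f, hxm s, ← mul_assoc, mul_assoc _ y f, hy, mul_add, mul_add, add_mul,
      add_mul, mul_assoc _ k, mul_assoc _ k', mul_pow_eq_of_skew hk, mul_pow_eq_of_skew hk',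
      ← mul_assoc _ f y, hxm, mul_smul_comm, mul_smul_comm, ← mul_assoc _ (x ^ s) k,
      ← mul_assoc _ (x ^ s) k', hs']
    simp only [mul_assoc]
  rw [key, hu, hv, zero_smul, zero_smul, add_zero, add_zero]

end SerreComb

/-- The data entering the definition of the positive part of a quantum group: a parameter `q` which
is not a root of unity, the symmetric form `b` on the root lattice, and the coefficients of the
Serre relations together with the identities they satisfy. -/
structure SerreDatum (K : Type*) [Field K] (n : ℕ) where
  q : K
  d : Fin n → ℤ
  b : Fin n → Fin n → ℤ
  N : Fin n → Fin n → ℕ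
  c : Fin n → Fin n → ℕ → K
  q_ne_zero : q ≠ 0
  zpow_ne_one : ∀ k : ℤ, k ≠ 0 → q ^ k ≠ 1
  d_pos : ∀ i, 0 < d i
  b_self : ∀ i, b i i = 2 * d i
  b_symm : ∀ i j, b i j = b j i
  c_zero : ∀ i j, c i j 0 = 1
  c_symm : ∀ i j, ∀ s ≤ N i j, c i j (N i j - s) = (-1) ^ N i j * c i j s
  c_succ : ∀ i j, i ≠ j → ∀ ε : ℤˣ, ∀ t < N i j,
    c i j (t + 1) * ∑ s ∈ Finset.range (t + 1), (q ^ (ε * b i i)) ^ s +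
      c i j t * (q ^ (ε * b i j) * (q ^ (ε * b i i)) ^ t) *
        ∑ s ∈ Finset.range (N i j - t), (q ^ (ε * b i i)) ^ s = 0
  c_sum : ∀ i j, i ≠ j → ∀ ε : ℤˣ,
    ∑ s ∈ Finset.range (N i j + 1), c i j s * (q ^ (ε * b i j)) ^ s = 0

namespace SerreDatum

variable {K : Type*} [Field K] {n : ℕ} (D : SerreDatum K n)

/-- The quantum Serre relations. -/
inductive Rel : FreeAlgebra K (Fin n) → FreeAlgebra K (Fin n) → Prop
  | serre (i j : Fin n) (h : i ≠ j) :
    Rel (serreComb (D.c i j) (D.N i j) (FreeAlgebra.ι K i) (FreeAlgebra.ι K j)) 0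

/-- The algebra generated by the `e i` subject to the quantum Serre relations. -/
def Alg : Type _ := RingQuot D.Rel

instance : Ring D.Alg := inferInstanceAs (Ring (RingQuot D.Rel))

instance : Algebra K D.Alg := inferInstanceAs (Algebra K (RingQuot D.Rel))

/-- The projection from the free algebra. -/
def proj : FreeAlgebra K (Fin n) →ₐ[K] D.Alg := RingQuot.mkAlgHom K D.Rel

/-- The generators of `D.Alg`. -/
def e (i : Fin n) : D.Alg := D.proj (FreeAlgebra.ι K i)

lemma proj_ι (i : Fin n) : D.proj (FreeAlgebra.ι K i) = D.e i := rfl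

lemma serre (i j : Fin n) (h : i ≠ j) : serreComb (D.c i j) (D.N i j) (D.e i) (D.e j) = 0 := by
  rw [e, e, ← map_serreComb]
  exact (RingQuot.mkAlgHom_rel K (Rel.serre i j h)).trans (map_zero (RingQuot.mkAlgHom K D.Rel))

section lift

variable {A : Type*} [Ring A] [Algebra K A]

/-- The universal property of `D.Alg`. -/
def lift (f : Fin n → A)
    (hf : ∀ i j, i ≠ j → serreComb (D.c i j) (D.N i j) (f i) (f j) = 0) : D.Alg →ₐ[K] A :=
  RingQuot.liftAlgHom K ⟨FreeAlgebra.lift K f, by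
    rintro _ _ ⟨i, j, h⟩
    rw [map_serreComb, map_zero, FreeAlgebra.lift_ι_apply, FreeAlgebra.lift_ι_apply, hf i j h]⟩

lemma lift_proj (f : Fin n → A) (hf) (y : FreeAlgebra K (Fin n)) :
    D.lift f hf (D.proj y) = FreeAlgebra.lift K f y :=
  RingQuot.liftAlgHom_mkAlgHom_apply K _ _ _

@[simp]
lemma lift_e (f : Fin n → A) (hf) (i : Fin n) : D.lift f hf (D.e i) = f i := by
  rw [e, lift_proj, FreeAlgebra.lift_ι_apply]

end lift

/-- The monomials in the free algebra. -/
def freeWord (K : Type*) [Field K] {n : ℕ} (l : List (Fin n)) : FreeAlgebra K (Fin n) :=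
  (l.map (FreeAlgebra.ι K)).prod

/-- The monomials in the generators. -/
def word (l : List (Fin n)) : D.Alg := (l.map D.e).prod

@[simp] lemma freeWord_nil : freeWord K ([] : List (Fin n)) = 1 := rfl

@[simp] lemma freeWord_cons (i : Fin n) (l : List (Fin n)) :
    freeWord K (i :: l) = FreeAlgebra.ι K i * freeWord K l := by simp [freeWord]

@[simp] lemma word_nil : D.word [] = 1 := rfl

@[simp] lemma word_cons (i : Fin n) (l : List (Fin n)) :
    D.word (i :: l) = D.e i * D.word l := by simp [word]

lemma proj_freeWord (l : List (Fin n)) : D.proj (freeWord K l) = D.word l := by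
  induction l with
  | nil => simp
  | cons i l ih => rw [freeWord_cons, map_mul, ih, word_cons, proj_ι]

lemma span_range_freeWord : Submodule.span K (Set.range (freeWord K (n := n))) = ⊤ := by
  rw [eq_top_iff]
  rintro y -
  induction y using FreeAlgebra.induction with
  | grade0 r =>
    rw [Algebra.algebraMap_eq_smul_one]
    exact Submodule.smul_mem _ _ (Submodule.subset_span ⟨[], rfl⟩)
  | grade1 i => exact Submodule.subset_span ⟨[i], by simp⟩
  | mul a b ha hb =>
    have h := Submodule.mul_mem_mul ha hb
    rw [Submodule.span_mul_span] at h
    refine Submodule.span_mono ?_ h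
    rintro _ ⟨_, ⟨l, rfl⟩, _, ⟨l', rfl⟩, rfl⟩
    exact ⟨l ++ l', by simp [freeWord]⟩
  | add a b ha hb => exact Submodule.add_mem _ ha hb

lemma proj_surjective : Function.Surjective D.proj := RingQuot.mkAlgHom_surjective K D.Rel

lemma span_range_word : Submodule.span K (Set.range D.word) = ⊤ := by
  have h : Set.range D.word = D.proj.toLinearMap '' Set.range (freeWord K (n := n)) := by
    rw [← Set.range_comp]
    exact congrArg Set.range (funext fun l => (D.proj_freeWord l).symm)
  rw [h, Submodule.span_image, span_range_freeWord, Submodule.map_top]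
  exact LinearMap.range_eq_top.mpr D.proj_surjective

lemma free_hom_ext {M : Type*} [AddCommMonoid M] [Module K M] {f g : FreeAlgebra K (Fin n) →ₗ[K] M}
    (h : ∀ l, f (freeWord K l) = g (freeWord K l)) : f = g :=
  LinearMap.ext_on_range span_range_freeWord h

lemma hom_ext {M : Type*} [AddCommMonoid M] [Module K M] {f g : D.Alg →ₗ[K] M}
    (h : ∀ l, f (D.word l) = g (D.word l)) : f = g :=
  LinearMap.ext_on_range D.span_range_word h

/-- The automorphism of the free algebra scaling the `j`-th generator by `q ^ c j`. -/
def freeScale (c : Fin n → ℤ) : FreeAlgebra K (Fin n) →ₐ[K] FreeAlgebra K (Fin n) :=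
  FreeAlgebra.lift K fun j => D.q ^ c j • FreeAlgebra.ι K j

/-- The automorphism of `D.Alg` scaling `e j` by `q ^ c j`. -/
def scale (c : Fin n → ℤ) : D.Alg →ₐ[K] D.Alg :=
  D.lift (fun j => D.q ^ c j • D.e j) fun i j h => by
    rw [serreComb_smul_smul, D.serre i j h, smul_zero]

@[simp] lemma freeScale_ι (c : Fin n → ℤ) (j : Fin n) :
    D.freeScale c (FreeAlgebra.ι K j) = D.q ^ c j • FreeAlgebra.ι K j := by simp [freeScale]

@[simp] lemma scale_e (c : Fin n → ℤ) (j : Fin n) : D.scale c (D.e j) = D.q ^ c j • D.e j := by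
  simp [scale]

lemma proj_freeScale (c : Fin n → ℤ) (y : FreeAlgebra K (Fin n)) :
    D.proj (D.freeScale c y) = D.scale c (D.proj y) := by
  have : D.proj.comp (D.freeScale c) = (D.scale c).comp D.proj := by
    ext j
    simp [proj_ι]
  exact DFunLike.congr_fun this y

/-- The action of `K_i^ε` on the free algebra. -/
abbrev freeKappa (ε : ℤˣ) (i : Fin n) := D.freeScale fun j => ε * D.b i j

/-- The action of `K_i^ε` on `D.Alg`. -/
abbrev kappa (ε : ℤˣ) (i : Fin n) := D.scale fun j => ε * D.b i j

/-- The algebra map `y ↦ !![y, r_i(y); 0, K_i^ε(y)]` encoding the skew derivation `r_i`. -/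
def freeMat (ε : ℤˣ) (i : Fin n) :
    FreeAlgebra K (Fin n) →ₐ[K] Matrix (Fin 2) (Fin 2) (FreeAlgebra K (Fin n)) :=
  FreeAlgebra.lift K fun j =>
    !![FreeAlgebra.ι K j, if i = j then 1 else 0; 0, D.freeKappa ε i (FreeAlgebra.ι K j)]

/-- The skew derivation `r_i` of the free algebra. -/
def freeDer (ε : ℤˣ) (i : Fin n) : FreeAlgebra K (Fin n) →ₗ[K] FreeAlgebra K (Fin n) where
  toFun y := D.freeMat ε i y 0 1
  map_add' x y := by simp
  map_smul' a x := by simp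

lemma freeMat_apply (ε : ℤˣ) (i : Fin n) (y : FreeAlgebra K (Fin n)) :
    D.freeMat ε i y = !![y, D.freeDer ε i y; 0, D.freeKappa ε i y] := by
  have h : ∀ y, D.freeMat ε i y 0 0 = y ∧ D.freeMat ε i y 1 0 = 0 ∧
      D.freeMat ε i y 1 1 = D.freeKappa ε i y := by
    intro y
    induction y using FreeAlgebra.induction with
    | grade0 r => simp [AlgHom.commutes, Matrix.algebraMap_matrix_apply]
    | grade1 j => simp [freeMat]
    | mul a b ha hb => simp [map_mul, Matrix.mul_apply, Fin.sum_univ_two, ha, hb]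
    | add a b ha hb => simp [ha, hb]
  obtain ⟨h1, h2, h3⟩ := h y
  rw [Matrix.eta_fin_two (D.freeMat ε i y), h1, h2, h3]
  rfl

lemma freeDer_mul (ε : ℤˣ) (i : Fin n) (x y : FreeAlgebra K (Fin n)) :
    D.freeDer ε i (x * y) = D.freeDer ε i x * D.freeKappa ε i y + x * D.freeDer ε i y := by
  have h : D.freeDer ε i (x * y) = (D.freeMat ε i x * D.freeMat ε i y) 0 1 := by
    rw [← map_mul]; rfl
  rw [h, freeMat_apply, freeMat_apply]
  simp [Matrix.mul_apply, Fin.sum_univ_two, add_comm]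

@[simp] lemma freeDer_ι (ε : ℤˣ) (i j : Fin n) :
    D.freeDer ε i (FreeAlgebra.ι K j) = if i = j then 1 else 0 := by
  simp [freeDer, freeMat]

@[simp] lemma freeDer_one (ε : ℤˣ) (i : Fin n) : D.freeDer ε i 1 = 0 := by
  simp [freeDer]

lemma freeDer_serre (ε : ℤˣ) (k i j : Fin n) (h : i ≠ j) :
    D.freeDer ε k (serreComb (D.c i j) (D.N i j) (FreeAlgebra.ι K i) (FreeAlgebra.ι K j)) = 0 := by
  set L := Algebra.lmul K (FreeAlgebra K (Fin n)) with hL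
  set r : Module.End K (FreeAlgebra K (Fin n)) := D.freeDer ε k
  set κ : Module.End K (FreeAlgebra K (Fin n)) := (D.freeKappa ε k).toLinearMap
  have hr : ∀ m, L (FreeAlgebra.ι K m) * (-r) = -r * L (FreeAlgebra.ι K m) +
      (if k = m then κ else 0) + 0 := by
    intro m
    ext1 y
    split_ifs with hkm <;> simp [hL, r, κ, freeDer_mul, hkm]
  have hκ : ∀ m, κ * L (FreeAlgebra.ι K m) =
      D.q ^ (ε * D.b k m) • (L (FreeAlgebra.ι K m) * κ) := by
    intro m
    ext1 y
    simp [κ, hL]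
  have key : serreComb (D.c i j) (D.N i j) (L (FreeAlgebra.ι K i)) (L (FreeAlgebra.ι K j)) * (-r) =
      -r * serreComb (D.c i j) (D.N i j) (L (FreeAlgebra.ι K i)) (L (FreeAlgebra.ι K j)) := by
    have hi := hr i
    have hj := hr j
    by_cases hki : k = i
    · subst hki
      rw [if_pos rfl] at hi
      rw [if_neg h, add_zero, add_zero] at hj
      exact serreComb_mul_comm_of_skew_left (v := D.q ^ (ε * D.b k k)) (v' := D.q ^ (ε * D.b k j))
        hi hj (hκ k) (by simp) (hκ j) (by simp) (D.c_succ k j h ε) (D.c_succ k j h ε)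
    · rw [if_neg hki, add_zero, add_zero] at hi
      by_cases hkj : k = j
      · subst hkj
        rw [if_pos rfl] at hj
        have hs := D.c_sum i k h ε
        rw [D.b_symm] at hs
        exact serreComb_mul_comm_of_skew_right (v := D.q ^ (ε * D.b k i))
          hi hj (hκ i) (by simp) hs hs
      · rw [if_neg hkj] at hj
        exact serreComb_mul_comm_of_skew_right (v := D.q ^ (ε * D.b i j))
          (u := D.q ^ (ε * D.b i j)) hi hj (by simp) (by simp) (D.c_sum i j h ε) (D.c_sum i j h ε)
  rw [← map_serreComb] at key
  have := DFunLike.congr_fun key 1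
  simpa [r, hL] using this.symm

/-- The algebra map `y ↦ !![y, r_i(y); 0, K_i^ε(y)]` encoding the skew derivation `r_i`. -/
def mat (ε : ℤˣ) (i : Fin n) : D.Alg →ₐ[K] Matrix (Fin 2) (Fin 2) D.Alg :=
  D.lift (fun j => D.proj.mapMatrix (D.freeMat ε i (FreeAlgebra.ι K j))) fun j k h => by
    refine (map_serreComb (D.proj.mapMatrix.comp (D.freeMat ε i)) _ _ _ _).symm.trans ?_
    rw [AlgHom.comp_apply, freeMat_apply, freeDer_serre _ _ _ _ _ h]
    ext a b
    fin_cases a <;> fin_cases b <;>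
      simp [map_serreComb, proj_ι, D.serre j k h, serreComb_smul_smul]

/-- The skew derivation `r_i` of `D.Alg`. -/
def der (ε : ℤˣ) (i : Fin n) : D.Alg →ₗ[K] D.Alg where
  toFun y := D.mat ε i y 0 1
  map_add' x y := by simp
  map_smul' a x := by simp

lemma mat_proj (ε : ℤˣ) (i : Fin n) (y : FreeAlgebra K (Fin n)) :
    D.mat ε i (D.proj y) = D.proj.mapMatrix (D.freeMat ε i y) := by
  have : (D.mat ε i).comp D.proj = D.proj.mapMatrix.comp (D.freeMat ε i) := by
    ext1
    funext j
    exact D.lift_e _ _ j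
  exact DFunLike.congr_fun this y

lemma proj_freeDer (ε : ℤˣ) (i : Fin n) (y : FreeAlgebra K (Fin n)) :
    D.proj (D.freeDer ε i y) = D.der ε i (D.proj y) := by
  simp [der, freeDer, mat_proj]

lemma der_mul (ε : ℤˣ) (i : Fin n) (x y : D.Alg) :
    D.der ε i (x * y) = D.der ε i x * D.kappa ε i y + x * D.der ε i y := by
  obtain ⟨x, rfl⟩ := D.proj_surjective x
  obtain ⟨y, rfl⟩ := D.proj_surjective y
  simp only [← map_mul, ← proj_freeDer, freeDer_mul, map_add]
  simp only [map_mul, proj_freeScale]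

@[simp] lemma der_e (ε : ℤˣ) (i j : Fin n) : D.der ε i (D.e j) = if i = j then 1 else 0 := by
  rw [← proj_ι, ← proj_freeDer, freeDer_ι]
  split_ifs <;> simp

@[simp] lemma der_one (ε : ℤˣ) (i : Fin n) : D.der ε i 1 = 0 := by
  simp [der]

lemma der_e_mul (ε : ℤˣ) (i j : Fin n) (y : D.Alg) :
    D.der ε i (D.e j * y) = D.e j * D.der ε i y + if i = j then D.kappa ε i y else 0 := by
  rw [der_mul, der_e, add_comm]
  split_ifs <;> simp

lemma freeDer_ι_mul (ε : ℤˣ) (i j : Fin n) (y : FreeAlgebra K (Fin n)) :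
    D.freeDer ε i (FreeAlgebra.ι K j * y) =
      FreeAlgebra.ι K j * D.freeDer ε i y + if i = j then D.freeKappa ε i y else 0 := by
  rw [freeDer_mul, freeDer_ι, add_comm]
  split_ifs <;> simp

/-- The weight of a word. -/
def wt (l : List (Fin n)) : Fin n → ℤ := (l.map fun i => Pi.single i 1).sum

@[simp] lemma wt_nil : wt ([] : List (Fin n)) = 0 := rfl

@[simp] lemma wt_cons (i : Fin n) (l : List (Fin n)) : wt (i :: l) = Pi.single i 1 + wt l := by
  simp [wt]

lemma wt_nonneg (l : List (Fin n)) : 0 ≤ wt l := by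
  induction l with
  | nil => simp
  | cons i l ih => rw [wt_cons]; exact add_nonneg (Pi.single_nonneg.mpr zero_le_one) ih

lemma sum_wt (l : List (Fin n)) : ∑ j, wt l j = l.length := by
  induction l with
  | nil => simp
  | cons i l ih => simp [Finset.sum_add_distrib, ih, add_comm]

lemma scale_word (c : Fin n → ℤ) (l : List (Fin n)) :
    D.scale c (D.word l) = D.q ^ (∑ j, c j * wt l j) • D.word l := by
  induction l with
  | nil => simp
  | cons i l ih =>
    simp [ih, smul_smul, mul_add, Finset.sum_add_distrib, zpow_add₀ D.q_ne_zero, Pi.single_apply,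
      mul_comm]

/-- The pairing of the simple root `α_i` with `β`. -/
def form (i : Fin n) (β : Fin n → ℤ) : ℤ := ∑ j, D.b i j * β j

lemma form_add (i : Fin n) (β γ : Fin n → ℤ) : D.form i (β + γ) = D.form i β + D.form i γ := by
  simp [form, mul_add, Finset.sum_add_distrib]

lemma form_single (i j : Fin n) : D.form i (Pi.single j 1) = D.b i j := by
  simp [form, Pi.single_apply]

lemma kappa_word (ε : ℤˣ) (i : Fin n) (l : List (Fin n)) :
    D.kappa ε i (D.word l) = D.q ^ (ε * D.form i (wt l)) • D.word l := by
  rw [scale_word, form, Finset.mul_sum]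
  simp only [mul_assoc]

lemma serreComb_single {A G : Type*} [Ring A] [Algebra K A] [AddCommGroup G] (c : ℕ → K) (N : ℕ)
    (g h : G) (x y : A) :
    serreComb c N (AddMonoidAlgebra.single g x) (AddMonoidAlgebra.single h y) =
      AddMonoidAlgebra.single (N • g + h) (serreComb c N x y) := by
  have hterm : ∀ s ∈ Finset.range (N + 1), c s • ((AddMonoidAlgebra.single g x) ^ (N - s) *
      AddMonoidAlgebra.single h y * (AddMonoidAlgebra.single g x) ^ s) =
      AddMonoidAlgebra.singleAddHom (N • g + h) (c s • (x ^ (N - s) * y * x ^ s)) := by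
    intro s hs
    rw [AddMonoidAlgebra.single_pow, AddMonoidAlgebra.single_pow,
      AddMonoidAlgebra.single_mul_single, AddMonoidAlgebra.single_mul_single,
      AddMonoidAlgebra.smul_single, AddMonoidAlgebra.singleAddHom_apply]
    congr 1
    rw [add_right_comm, ← add_nsmul, Nat.sub_add_cancel (Finset.mem_range_succ_iff.mp hs)]
  refine (Finset.sum_congr rfl hterm).trans ?_
  rw [← map_sum]
  rfl

/-- The grading of `D.Alg` by the root lattice, as an algebra map. -/
def grade : D.Alg →ₐ[K] AddMonoidAlgebra D.Alg (Fin n → ℤ) :=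
  D.lift (fun j => AddMonoidAlgebra.single (Pi.single j 1) (D.e j)) fun i j h => by
    refine (serreComb_single (D.c i j) (D.N i j) _ _ (D.e i) (D.e j)).trans ?_
    rw [D.serre i j h, AddMonoidAlgebra.single_zero]

lemma grade_word (l : List (Fin n)) :
    D.grade (D.word l) = AddMonoidAlgebra.single (wt l) (D.word l) := by
  induction l with
  | nil => simp [AddMonoidAlgebra.one_def]
  | cons i l ih =>
    rw [word_cons, map_mul, ih, show D.grade (D.e i) = _ from D.lift_e _ _ i,
      AddMonoidAlgebra.single_mul_single, wt_cons]

/-- The projection onto the weight space of weight `β`. -/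
def comp (β : Fin n → ℤ) : D.Alg →ₗ[K] D.Alg where
  toFun y := (D.grade y).coeff β
  map_add' x y := by simp
  map_smul' a x := by simp

lemma comp_word (β : Fin n → ℤ) (l : List (Fin n)) :
    D.comp β (D.word l) = if wt l = β then D.word l else 0 := by
  simp [comp, grade_word, AddMonoidAlgebra.coeff_single, Finsupp.single_apply]

lemma exists_eq_sum_comp (y : D.Alg) :
    ∃ S : Finset (Fin n → ℤ), ∀ T, S ⊆ T → y = ∑ β ∈ T, D.comp β y := by
  classical
  have hy : y ∈ Submodule.span K (Set.range D.word) := by simp [D.span_range_word]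
  induction hy using Submodule.span_induction with
  | mem x hx =>
    obtain ⟨l, rfl⟩ := hx
    refine ⟨{wt l}, fun T hT => ?_⟩
    simp only [comp_word]
    rw [Finset.sum_ite_eq, if_pos (Finset.singleton_subset_iff.mp hT)]
  | zero => exact ⟨∅, by simp⟩
  | add x y _ _ hx hy =>
    obtain ⟨S, hS⟩ := hx
    obtain ⟨S', hS'⟩ := hy
    refine ⟨S ∪ S', fun T hT => ?_⟩
    simp only [map_add, Finset.sum_add_distrib]
    rw [← hS T (Finset.union_subset_left hT), ← hS' T (Finset.union_subset_right hT)]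
  | smul a x _ hx =>
    obtain ⟨S, hS⟩ := hx
    exact ⟨S, fun T hT => by simp only [map_smul, ← Finset.smul_sum, ← hS T hT]⟩

lemma eq_zero_of_comp_eq_zero {y : D.Alg} (h : ∀ β, D.comp β y = 0) : y = 0 := by
  obtain ⟨S, hS⟩ := D.exists_eq_sum_comp y
  rw [hS S subset_rfl]
  exact Finset.sum_eq_zero fun β _ => h β

lemma comp_e_mul (β : Fin n → ℤ) (j : Fin n) (y : D.Alg) :
    D.comp β (D.e j * y) = D.e j * D.comp (β - Pi.single j 1) y := by
  have : D.comp β ∘ₗ LinearMap.mulLeft K (D.e j) =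
      LinearMap.mulLeft K (D.e j) ∘ₗ D.comp (β - Pi.single j 1) := by
    refine D.hom_ext fun l => ?_
    have hiff : Pi.single j 1 + wt l = β ↔ wt l = β - Pi.single j 1 := by
      rw [eq_sub_iff_add_eq, add_comm]
    simp [← word_cons, comp_word, hiff]
  exact LinearMap.congr_fun this y

lemma comp_scale (β c : Fin n → ℤ) (y : D.Alg) :
    D.comp β (D.scale c y) = D.scale c (D.comp β y) := by
  have : D.comp β ∘ₗ (D.scale c).toLinearMap = (D.scale c).toLinearMap ∘ₗ D.comp β := by
    refine D.hom_ext fun l => ?_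
    simp only [LinearMap.comp_apply, AlgHom.toLinearMap_apply, comp_word, scale_word, map_smul]
    split_ifs <;> simp [scale_word]
  exact LinearMap.congr_fun this y

lemma comp_der (ε : ℤˣ) (i : Fin n) (β : Fin n → ℤ) (y : D.Alg) :
    D.comp β (D.der ε i y) = D.der ε i (D.comp (β + Pi.single i 1) y) := by
  have : D.comp β ∘ₗ D.der ε i = D.der ε i ∘ₗ D.comp (β + Pi.single i 1) := by
    refine D.hom_ext fun l => ?_
    simp only [LinearMap.comp_apply]
    induction l generalizing β with
    | nil =>
      simp only [word_nil, der_one, map_zero]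
      have := D.comp_word (β + Pi.single i 1) []
      rw [word_nil] at this
      rw [this]
      split_ifs <;> simp
    | cons j l ih =>
      rw [word_cons, der_e_mul, comp_e_mul, der_e_mul, map_add, comp_e_mul, ih,
        show β + Pi.single i 1 - Pi.single j 1 = β - Pi.single j 1 + Pi.single i 1 by abel]
      split_ifs with hij
      · subst hij
        rw [comp_scale, sub_add_cancel]
      · simp
  exact LinearMap.congr_fun this y

/-- The skew derivations `r_i` for all `i` at once. -/
def derPi : D.Alg →ₗ[K] (Fin n → D.Alg) := LinearMap.pi fun i => D.der 1 i

lemma mem_ker_derPi {y : D.Alg} : y ∈ LinearMap.ker D.derPi ↔ ∀ i, D.der 1 i y = 0 := by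
  simp [derPi, funext_iff]

lemma comp_mem_ker_derPi {y : D.Alg} (hy : y ∈ LinearMap.ker D.derPi) (β : Fin n → ℤ) :
    D.comp β y ∈ LinearMap.ker D.derPi := by
  rw [mem_ker_derPi] at hy ⊢
  intro i
  have := D.comp_der 1 i (β - Pi.single i 1) y
  rw [hy i, map_zero, sub_add_cancel] at this
  exact this.symm

/-- The span of the words whose length lies in `S`. -/
def lenSpan (S : Set ℕ) : Submodule K D.Alg :=
  Submodule.span K (D.word '' {l | l.length ∈ S})

/-- The span of the words of weight `β`. -/
def wtSpan (β : Fin n → ℤ) : Submodule K D.Alg :=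
  Submodule.span K (D.word '' {l | wt l = β})

lemma comp_mem_wtSpan (β : Fin n → ℤ) (y : D.Alg) : D.comp β y ∈ D.wtSpan β := by
  have hy : y ∈ Submodule.span K (Set.range D.word) := by simp [D.span_range_word]
  induction hy using Submodule.span_induction with
  | mem x hx =>
    obtain ⟨l, rfl⟩ := hx
    rw [comp_word]
    split_ifs with hl
    · exact Submodule.subset_span ⟨l, hl, rfl⟩
    · exact zero_mem _
  | zero => rw [map_zero]; exact zero_mem _
  | add x y _ _ hx hy => rw [map_add]; exact add_mem hx hy
  | smul a x _ hx => rw [map_smul]; exact Submodule.smul_mem _ _ hx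

lemma comp_eq_zero_of_mem_lenSpan {S : Set ℕ} {y : D.Alg} (hy : y ∈ D.lenSpan S)
    {β : Fin n → ℤ} (hβ : ∀ l, wt l = β → l.length ∉ S) : D.comp β y = 0 := by
  have h : D.lenSpan S ≤ LinearMap.ker (D.comp β) := by
    rw [lenSpan, Submodule.span_le]
    rintro _ ⟨l, hl, rfl⟩
    rw [SetLike.mem_coe, LinearMap.mem_ker, comp_word, if_neg fun h => hβ l h hl]
  exact h hy

/-- An element of `D.Alg` killed by all skew derivations vanishes if its weight components do. -/
lemma eq_zero_of_mem_lenSpan_of_mem_ker {S : Set ℕ}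
    (hS : ∀ l : List (Fin n), l.length ∈ S →
      ∀ y ∈ D.wtSpan (wt l), y ∈ LinearMap.ker D.derPi → y = 0)
    {y : D.Alg} (hy : y ∈ D.lenSpan S) (hker : y ∈ LinearMap.ker D.derPi) : y = 0 := by
  refine D.eq_zero_of_comp_eq_zero fun β => ?_
  by_cases hβ : ∃ l, wt l = β ∧ l.length ∈ S
  · obtain ⟨l, rfl, hl⟩ := hβ
    exact hS l hl _ (D.comp_mem_wtSpan _ y) (D.comp_mem_ker_derPi hker _)
  · push Not at hβ
    exact D.comp_eq_zero_of_mem_lenSpan hy hβ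

lemma scale_scale (c c' : Fin n → ℤ) (y : D.Alg) :
    D.scale c (D.scale c' y) = D.scale (c + c') y := by
  have : (D.scale c).toLinearMap ∘ₗ (D.scale c').toLinearMap = (D.scale (c + c')).toLinearMap := by
    refine D.hom_ext fun l => ?_
    simp [scale_word, smul_smul, ← zpow_add₀ D.q_ne_zero, ← Finset.sum_add_distrib, add_mul,
      add_comm]
  exact LinearMap.congr_fun this y

lemma scale_scale_comm (c c' : Fin n → ℤ) (y : D.Alg) :
    D.scale c (D.scale c' y) = D.scale c' (D.scale c y) := by
  rw [scale_scale, scale_scale, add_comm]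

/-- The span of the words of length `k` in the free algebra. -/
def freeSpan (K : Type*) [Field K] (n k : ℕ) : Submodule K (FreeAlgebra K (Fin n)) :=
  Submodule.span K (freeWord K '' {l | l.length = k})

lemma freeWord_mem_freeSpan (l : List (Fin n)) : freeWord K l ∈ freeSpan K n l.length :=
  Submodule.subset_span ⟨l, rfl, rfl⟩

lemma ι_mul_mem_freeSpan {k : ℕ} (j : Fin n) {y : FreeAlgebra K (Fin n)}
    (hy : y ∈ freeSpan K n k) : FreeAlgebra.ι K j * y ∈ freeSpan K n (k + 1) := by
  induction hy using Submodule.span_induction with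
  | mem x hx =>
    obtain ⟨l, hl, rfl⟩ := hx
    exact Submodule.subset_span ⟨j :: l, by simpa using hl, by simp⟩
  | zero => simp
  | add x y _ _ hx hy => rw [mul_add]; exact add_mem hx hy
  | smul a x _ hx => rw [mul_smul_comm]; exact Submodule.smul_mem _ _ hx

lemma freeScale_freeWord_mem (c : Fin n → ℤ) (l : List (Fin n)) :
    D.freeScale c (freeWord K l) ∈ freeSpan K n l.length := by
  induction l with
  | nil => rw [freeWord_nil, map_one]; exact freeWord_mem_freeSpan []
  | cons j l ih =>
    rw [freeWord_cons, map_mul, freeScale_ι, smul_mul_assoc]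
    exact Submodule.smul_mem _ _ (ι_mul_mem_freeSpan j ih)

lemma freeDer_mem_freeSpan (ε : ℤˣ) (i : Fin n) {k : ℕ} {y : FreeAlgebra K (Fin n)}
    (hy : y ∈ freeSpan K n (k + 1)) : D.freeDer ε i y ∈ freeSpan K n k := by
  suffices h : ∀ k, ∀ l : List (Fin n), l.length = k + 1 →
      D.freeDer ε i (freeWord K l) ∈ freeSpan K n k by
    have hle : freeSpan K n (k + 1) ≤ (freeSpan K n k).comap (D.freeDer ε i) := by
      rw [freeSpan, Submodule.span_le]
      rintro _ ⟨l, hl, rfl⟩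
      exact h k l hl
    exact hle hy
  intro k
  induction k with
  | zero =>
    intro l hl
    obtain ⟨j, rfl⟩ := List.length_eq_one_iff.mp hl
    rw [freeWord_cons, freeDer_ι_mul, freeWord_nil, freeDer_one, map_one, mul_zero, zero_add]
    split_ifs
    · exact freeWord_mem_freeSpan []
    · exact zero_mem _
  | succ k ih =>
    rintro (_ | ⟨j, l⟩) hl
    · simp at hl
    · rw [List.length_cons, Nat.add_right_cancel_iff] at hl
      rw [freeWord_cons, freeDer_ι_mul]
      refine add_mem (ι_mul_mem_freeSpan j (ih l hl)) ?_
      split_ifs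
      · exact hl ▸ D.freeScale_freeWord_mem _ l
      · exact zero_mem _

/-- Left multiplication by the (braided) coproduct of a generator. -/
def copGen (j : Fin n) : Module.End K (D.Alg ⊗[K] D.Alg) :=
  TensorProduct.map (LinearMap.mulLeft K (D.e j)) LinearMap.id +
    TensorProduct.map (D.kappa 1 j).toLinearMap (LinearMap.mulLeft K (D.e j))

@[simp] lemma copGen_tmul (j : Fin n) (u v : D.Alg) :
    D.copGen j (u ⊗ₜ v) = (D.e j * u) ⊗ₜ v + D.kappa 1 j u ⊗ₜ (D.e j * v) := by
  simp [copGen]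

/-- The coproduct of the free algebra, with values in `D.Alg ⊗ D.Alg`. -/
def cop : FreeAlgebra K (Fin n) →ₗ[K] D.Alg ⊗[K] D.Alg :=
  LinearMap.applyₗ (1 ⊗ₜ 1) ∘ₗ (FreeAlgebra.lift K D.copGen).toLinearMap

@[simp] lemma cop_one : D.cop 1 = 1 ⊗ₜ 1 := by simp [cop]

@[simp] lemma cop_ι_mul (j : Fin n) (y : FreeAlgebra K (Fin n)) :
    D.cop (FreeAlgebra.ι K j * y) = D.copGen j (D.cop y) := by simp [cop]

lemma map_kappa_copGen (i j : Fin n) (z : D.Alg ⊗[K] D.Alg) :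
    TensorProduct.map (D.kappa 1 i).toLinearMap (D.kappa 1 i).toLinearMap (D.copGen j z) =
      D.q ^ D.b i j • D.copGen j
        (TensorProduct.map (D.kappa 1 i).toLinearMap (D.kappa 1 i).toLinearMap z) := by
  induction z using TensorProduct.induction_on with
  | zero => simp
  | tmul u v =>
    have h : D.kappa 1 i (D.kappa 1 j u) = D.kappa 1 j (D.kappa 1 i u) := D.scale_scale_comm _ _ u
    simp only [copGen_tmul, map_add, TensorProduct.map_tmul, AlgHom.toLinearMap_apply, map_mul, h]
    simp [TensorProduct.smul_tmul', TensorProduct.tmul_smul]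
  | add x y hx hy => simp only [map_add, hx, hy, smul_add]

lemma map_kappa_cop (i : Fin n) (y : FreeAlgebra K (Fin n)) :
    TensorProduct.map (D.kappa 1 i).toLinearMap (D.kappa 1 i).toLinearMap (D.cop y) =
      D.cop (D.freeKappa 1 i y) := by
  have : TensorProduct.map (D.kappa 1 i).toLinearMap (D.kappa 1 i).toLinearMap ∘ₗ D.cop =
      D.cop ∘ₗ (D.freeKappa 1 i).toLinearMap := by
    refine free_hom_ext fun l => ?_
    simp only [LinearMap.comp_apply, AlgHom.toLinearMap_apply]
    induction l with
    | nil => simp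
    | cons j l ih =>
      rw [freeWord_cons, cop_ι_mul, map_kappa_copGen, ih, map_mul, freeScale_ι, smul_mul_assoc,
        map_smul, cop_ι_mul]
      simp
  exact LinearMap.congr_fun this y

lemma lTensor_der_copGen (i j : Fin n) (z : D.Alg ⊗[K] D.Alg) :
    (D.der 1 i).lTensor D.Alg (D.copGen j z) =
      D.copGen j ((D.der 1 i).lTensor D.Alg z) + if i = j then
        TensorProduct.map (D.kappa 1 i).toLinearMap (D.kappa 1 i).toLinearMap z else 0 := by
  induction z using TensorProduct.induction_on with
  | zero => simp
  | tmul u v =>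
    split_ifs with h
    · subst h
      simp [der_e_mul, TensorProduct.tmul_add, add_assoc]
    · simp [der_e_mul, h]
  | add x y hx hy =>
    simp only [map_add, hx, hy]
    split_ifs <;> abel

lemma lTensor_der_cop (i : Fin n) (y : FreeAlgebra K (Fin n)) :
    (D.der 1 i).lTensor D.Alg (D.cop y) = D.cop (D.freeDer 1 i y) := by
  have : (D.der 1 i).lTensor D.Alg ∘ₗ D.cop = D.cop ∘ₗ D.freeDer 1 i := by
    refine free_hom_ext fun l => ?_
    simp only [LinearMap.comp_apply]
    induction l with
    | nil => simp
    | cons j l ih =>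
      rw [freeWord_cons, cop_ι_mul, lTensor_der_copGen, ih, map_kappa_cop, freeDer_ι_mul, map_add,
        cop_ι_mul]
      split_ifs <;> simp
  exact LinearMap.congr_fun this y

lemma word_mem_lenSpan {S : Set ℕ} {l : List (Fin n)} (hl : l.length ∈ S) :
    D.word l ∈ D.lenSpan S :=
  Submodule.subset_span ⟨l, hl, rfl⟩

lemma lenSpan_mono {S T : Set ℕ} (h : S ⊆ T) : D.lenSpan S ≤ D.lenSpan T :=
  Submodule.span_mono (Set.image_mono fun _ hl => h hl)

lemma e_mul_mem_lenSpan {S T : Set ℕ} (h : ∀ k ∈ S, k + 1 ∈ T) (j : Fin n) {y : D.Alg}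
    (hy : y ∈ D.lenSpan S) : D.e j * y ∈ D.lenSpan T := by
  have hle : D.lenSpan S ≤ (D.lenSpan T).comap (LinearMap.mulLeft K (D.e j)) := by
    rw [lenSpan, Submodule.span_le]
    rintro _ ⟨l, hl, rfl⟩
    exact Submodule.subset_span ⟨j :: l, h _ hl, by simp⟩
  exact hle hy

/-- The tensors whose right factor has word lengths strictly between `0` and `k`. -/
def midSpan (k : ℕ) : Submodule K (D.Alg ⊗[K] D.Alg) :=
  LinearMap.range ((D.lenSpan (Set.Ioo 0 k)).subtype.lTensor D.Alg)

lemma tmul_mem_midSpan {k : ℕ} (u : D.Alg) {v : D.Alg} (hv : v ∈ D.lenSpan (Set.Ioo 0 k)) :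
    u ⊗ₜ v ∈ D.midSpan k :=
  ⟨u ⊗ₜ ⟨v, hv⟩, by simp⟩

lemma copGen_mem_midSpan {k : ℕ} (j : Fin n) {z : D.Alg ⊗[K] D.Alg} (hz : z ∈ D.midSpan k) :
    D.copGen j z ∈ D.midSpan (k + 1) := by
  obtain ⟨t, rfl⟩ := hz
  induction t using TensorProduct.induction_on with
  | zero => simp
  | tmul u v =>
    rw [LinearMap.lTensor_tmul, copGen_tmul]
    refine add_mem (D.tmul_mem_midSpan _ (D.lenSpan_mono ?_ v.2)) (D.tmul_mem_midSpan _
      (D.e_mul_mem_lenSpan ?_ j v.2))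
    · exact Set.Ioo_subset_Ioo_right k.le_succ
    · exact fun m hm => ⟨m.succ_pos, Nat.add_lt_add_right hm.2 1⟩
  | add x y hx hy => rw [map_add, map_add]; exact add_mem hx hy

lemma cop_freeWord_sub_mem (l : List (Fin n)) (hl : l ≠ []) :
    D.cop (freeWord K l) - D.word l ⊗ₜ 1 - 1 ⊗ₜ D.word l ∈ D.midSpan l.length := by
  induction l with
  | nil => exact absurd rfl hl
  | cons j l ih =>
    rcases eq_or_ne l [] with rfl | hl'
    · rw [freeWord_cons, cop_ι_mul]
      simp
    · have hpos := List.length_pos_iff.mpr hl'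
      have h := D.copGen_mem_midSpan j (ih hl')
      rw [map_sub, map_sub, ← cop_ι_mul, ← freeWord_cons, copGen_tmul, copGen_tmul, map_one,
        mul_one, ← word_cons] at h
      have h1 := D.tmul_mem_midSpan (k := l.length + 1) (D.kappa 1 j (D.word l))
        (D.word_mem_lenSpan (l := [j]) ⟨one_pos, Nat.lt_add_of_pos_left hpos⟩)
      have h2 := D.tmul_mem_midSpan (k := l.length + 1) (D.e j)
        (D.word_mem_lenSpan (l := l) ⟨hpos, Nat.lt_succ_self _⟩)
      rw [word_cons, word_nil, mul_one] at h1
      rw [List.length_cons]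
      convert add_mem (add_mem h h1) h2 using 1
      abel

lemma cop_sub_mem {k : ℕ} (hk : k ≠ 0) {y : FreeAlgebra K (Fin n)} (hy : y ∈ freeSpan K n k) :
    D.cop y - D.proj y ⊗ₜ 1 - 1 ⊗ₜ D.proj y ∈ D.midSpan k := by
  induction hy using Submodule.span_induction with
  | mem x hx =>
    obtain ⟨l, rfl, rfl⟩ := hx
    rw [proj_freeWord]
    exact D.cop_freeWord_sub_mem l (by rintro rfl; exact hk rfl)
  | zero => simp
  | add x y _ _ hx hy =>
    convert add_mem hx hy using 1
    rw [map_add, map_add, TensorProduct.add_tmul, TensorProduct.tmul_add]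
    abel
  | smul a x _ hx =>
    convert Submodule.smul_mem _ a hx using 1
    rw [map_smul, map_smul, TensorProduct.tmul_smul, ← TensorProduct.smul_tmul', smul_sub, smul_sub]

lemma eq_zero_of_mem_midSpan {k : ℕ}
    (hinj : ∀ v ∈ D.lenSpan (Set.Ioo 0 k), v ∈ LinearMap.ker D.derPi → v = 0)
    {z : D.Alg ⊗[K] D.Alg} (hz : z ∈ D.midSpan k)
    (hder : ∀ i, (D.der 1 i).lTensor D.Alg z = 0) : z = 0 := by
  obtain ⟨t, rfl⟩ := hz
  have hf : Function.Injective (D.derPi ∘ₗ (D.lenSpan (Set.Ioo 0 k)).subtype) := by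
    rw [← LinearMap.ker_eq_bot, LinearMap.ker_eq_bot']
    exact fun v hv => Subtype.ext (hinj v v.2 hv)
  have hsum : D.derPi = ∑ i, LinearMap.single K (fun _ => D.Alg) i ∘ₗ D.der 1 i := by
    ext y i
    simp [derPi, Finset.sum_apply, Pi.single_apply]
  have ht : (D.derPi ∘ₗ (D.lenSpan (Set.Ioo 0 k)).subtype).lTensor D.Alg t = 0 := by
    rw [LinearMap.lTensor_comp, LinearMap.comp_apply, hsum, ← LinearMap.coe_lTensorHom, map_sum,
      LinearMap.sum_apply]
    refine Finset.sum_eq_zero fun i _ => ?_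
    rw [LinearMap.coe_lTensorHom, LinearMap.lTensor_comp, LinearMap.comp_apply, hder i, map_zero]
  rw [Module.Flat.lTensor_preserves_injective_linearMap (M := D.Alg) _ hf
    (ht.trans (map_zero _).symm), map_zero]

lemma cop_eq_of_freeDer {k : ℕ} (hk : k ≠ 0)
    (hinj : ∀ v ∈ D.lenSpan (Set.Ioo 0 k), v ∈ LinearMap.ker D.derPi → v = 0)
    {y : FreeAlgebra K (Fin n)} (hy : y ∈ freeSpan K n k)
    (hcop : ∀ i, D.cop (D.freeDer 1 i y) = 0) (hder : ∀ i, D.der 1 i (D.proj y) = 0) :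
    D.cop y = D.proj y ⊗ₜ 1 + 1 ⊗ₜ D.proj y := by
  have h := D.eq_zero_of_mem_midSpan hinj (D.cop_sub_mem hk hy) fun i => by
    simp [lTensor_der_cop, hcop, hder]
  rw [sub_sub] at h
  exact sub_eq_zero.mp h

lemma cop_eq_zero {m : ℕ}
    (hinj : ∀ v ∈ D.lenSpan (Set.Ioo 0 m), v ∈ LinearMap.ker D.derPi → v = 0)
    {k : ℕ} (hk : k < m) {y : FreeAlgebra K (Fin n)} (hy : y ∈ freeSpan K n k)
    (h0 : D.proj y = 0) : D.cop y = 0 := by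
  induction k generalizing y with
  | zero =>
    have hset : {l : List (Fin n) | l.length = 0} = {[]} := by ext; simp
    rw [freeSpan, hset, Set.image_singleton, Submodule.mem_span_singleton] at hy
    obtain ⟨a, rfl⟩ := hy
    rw [freeWord_nil, map_smul, map_one] at h0
    rw [freeWord_nil, map_smul, cop_one, TensorProduct.smul_tmul', h0, TensorProduct.zero_tmul]
  | succ k ih =>
    have h := D.cop_eq_of_freeDer k.succ_ne_zero
      (fun v hv => hinj v (D.lenSpan_mono (Set.Ioo_subset_Ioo_right hk.le) hv)) hy
      (fun i => ih (Nat.lt_of_succ_lt hk) (D.freeDer_mem_freeSpan 1 i hy)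
        (by rw [proj_freeDer, h0, map_zero]))
      (fun i => by rw [h0, map_zero])
    rw [h, h0, TensorProduct.zero_tmul, TensorProduct.tmul_zero, add_zero]

/-- An element killed by all skew derivations is primitive, provided the skew derivations are
jointly injective in smaller degrees. -/
lemma cop_eq_of_der_eq_zero {m : ℕ} (hm : m ≠ 0)
    (hinj : ∀ v ∈ D.lenSpan (Set.Ioo 0 m), v ∈ LinearMap.ker D.derPi → v = 0)
    {y : FreeAlgebra K (Fin n)} (hy : y ∈ freeSpan K n m) (hder : ∀ i, D.der 1 i (D.proj y) = 0) :
    D.cop y = D.proj y ⊗ₜ 1 + 1 ⊗ₜ D.proj y := by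
  obtain ⟨k, rfl⟩ := Nat.exists_eq_succ_of_ne_zero hm
  refine D.cop_eq_of_freeDer hm hinj hy (fun i => ?_) hder
  exact D.cop_eq_zero hinj (Nat.lt_succ_self k) (D.freeDer_mem_freeSpan 1 i hy)
    (by rw [proj_freeDer, hder])

/-- The anti-automorphism fixing the generators, as an algebra map to the opposite algebra. -/
def revAlgHom : D.Alg →ₐ[K] D.Algᵐᵒᵖ :=
  D.lift (fun j => MulOpposite.op (D.e j)) fun i j h => by
    rw [← MulOpposite.unop_inj, unop_serreComb_op (D.c_symm i j), D.serre i j h, smul_zero,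
      MulOpposite.unop_zero]

/-- The anti-automorphism fixing the generators. -/
def rev : D.Alg →ₗ[K] D.Alg :=
  (MulOpposite.opLinearEquiv K).symm.toLinearMap ∘ₗ D.revAlgHom.toLinearMap

@[simp] lemma rev_one : D.rev 1 = 1 := by simp [rev]

@[simp] lemma rev_e (j : Fin n) : D.rev (D.e j) = D.e j := by simp [rev, revAlgHom]

@[simp] lemma rev_mul (x y : D.Alg) : D.rev (x * y) = D.rev y * D.rev x := by simp [rev]

lemma rev_word (l : List (Fin n)) : D.rev (D.word l) = D.word l.reverse := by
  induction l with
  | nil => simp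
  | cons j l ih => rw [word_cons, rev_mul, ih, rev_e]; simp [word]

@[simp] lemma rev_rev (y : D.Alg) : D.rev (D.rev y) = y := by
  have : D.rev ∘ₗ D.rev = LinearMap.id := D.hom_ext fun l => by simp [rev_word]
  exact LinearMap.congr_fun this y

lemma der_neg_one (i : Fin n) (y : D.Alg) :
    D.der (-1) i y = D.kappa (-1) i (D.rev (D.der 1 i (D.rev y))) := by
  have : D.der (-1) i = (D.kappa (-1) i).toLinearMap ∘ₗ D.rev ∘ₗ D.der 1 i ∘ₗ D.rev := by
    refine D.hom_ext fun l => ?_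
    simp only [LinearMap.comp_apply, AlgHom.toLinearMap_apply]
    induction l with
    | nil => simp
    | cons j l ih =>
      rw [word_cons, der_e_mul, ih, rev_mul, rev_e, der_mul, der_e, scale_e, map_add, mul_smul_comm,
        map_smul, rev_mul, rev_e, map_add, map_smul, map_mul, scale_e, smul_mul_assoc, smul_smul,
        ← zpow_add₀ D.q_ne_zero]
      split_ifs <;> simp
  exact LinearMap.congr_fun this y

/-- The scalar by which the antipode differs from `rev` on the weight space of weight `β`. -/
def antiCoeff (β : Fin n → ℤ) : K :=
  (-1) ^ (∑ j, β j) * D.q ^ ((∑ j, β j * D.form j β - 2 * ∑ j, D.d j * β j) / 2)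

lemma antiCoeff_zero : D.antiCoeff 0 = 1 := by simp [antiCoeff]

lemma antiCoeff_single_add (i : Fin n) (β : Fin n → ℤ) :
    D.antiCoeff (Pi.single i 1 + β) = -(D.q ^ D.form i β * D.antiCoeff β) := by
  have h1 : ∑ j, (Pi.single i 1 + β : Fin n → ℤ) j = ∑ j, β j + 1 := by
    simp [Finset.sum_add_distrib, add_comm]
  have h2 : ∑ j, β j * D.b j i = D.form i β :=
    Finset.sum_congr rfl fun j _ => by rw [D.b_symm, mul_comm]
  have h3 : ∑ j, (Pi.single i 1 + β : Fin n → ℤ) j * D.form j (Pi.single i 1 + β) -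
      2 * ∑ j, D.d j * (Pi.single i 1 + β : Fin n → ℤ) j =
      (∑ j, β j * D.form j β - 2 * ∑ j, D.d j * β j) + D.form i β * 2 := by
    simp only [Pi.add_apply, form_add, form_single, mul_add, add_mul, Finset.sum_add_distrib, h2]
    simp [Pi.single_apply, D.b_self]
    ring
  rw [antiCoeff, h1, h3, Int.add_mul_ediv_right _ _ two_ne_zero, zpow_add₀ D.q_ne_zero,
    zpow_add_one₀ (neg_ne_zero.mpr one_ne_zero), antiCoeff]
  ring

/-- The antipode of the braided Hopf algebra `D.Alg`. -/
def anti : D.Alg →ₗ[K] D.Alg :=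
  (Finsupp.lsum K fun β => D.antiCoeff β • D.rev) ∘ₗ
    (AddMonoidAlgebra.coeffLinearEquiv K).toLinearMap ∘ₗ D.grade.toLinearMap

lemma anti_word (l : List (Fin n)) : D.anti (D.word l) = D.antiCoeff (wt l) • D.rev (D.word l) := by
  simp [anti, grade_word]

lemma anti_e_mul (j : Fin n) (y : D.Alg) :
    D.anti (D.e j * y) = -(D.anti (D.kappa 1 j y) * D.e j) := by
  have : D.anti ∘ₗ LinearMap.mulLeft K (D.e j) =
      -(LinearMap.mulRight K (D.e j) ∘ₗ D.anti ∘ₗ (D.kappa 1 j).toLinearMap) := by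
    refine D.hom_ext fun l => ?_
    simp only [LinearMap.neg_apply, LinearMap.comp_apply, LinearMap.mulLeft_apply,
      LinearMap.mulRight_apply, AlgHom.toLinearMap_apply, kappa_word, map_smul, anti_word]
    rw [← word_cons, anti_word, wt_cons, antiCoeff_single_add, word_cons, rev_mul, rev_e]
    simp [smul_smul]
  exact LinearMap.congr_fun this y

lemma anti_eq_smul_rev {β : Fin n → ℤ} {y : D.Alg} (hy : y ∈ D.wtSpan β) :
    D.anti y = D.antiCoeff β • D.rev y := by
  have h : D.wtSpan β ≤ LinearMap.eqLocus D.anti (D.antiCoeff β • D.rev) := by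
    rw [wtSpan, Submodule.span_le]
    rintro _ ⟨l, rfl, rfl⟩
    exact D.anti_word l
  exact h hy

lemma mul_anti_cop {k : ℕ} (hk : k ≠ 0) {y : FreeAlgebra K (Fin n)} (hy : y ∈ freeSpan K n k) :
    LinearMap.mul' K D.Alg (TensorProduct.map D.anti LinearMap.id (D.cop y)) = 0 := by
  have hgen : ∀ j z, LinearMap.mul' K D.Alg
      (TensorProduct.map D.anti LinearMap.id (D.copGen j z)) = 0 := by
    intro j z
    induction z using TensorProduct.induction_on with
    | zero => simp
    | tmul u v => simp only [copGen_tmul, map_add, TensorProduct.map_tmul, anti_e_mul,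
        LinearMap.mul'_apply, LinearMap.id_apply, neg_mul, mul_assoc, neg_add_cancel]
    | add x y hx hy => simp only [map_add, hx, hy, add_zero]
  have h : freeSpan K n k ≤ LinearMap.ker
      (LinearMap.mul' K D.Alg ∘ₗ TensorProduct.map D.anti LinearMap.id ∘ₗ D.cop) := by
    rw [freeSpan, Submodule.span_le]
    rintro _ ⟨_ | ⟨j, l⟩, hl, rfl⟩
    · exact absurd hl.symm hk
    · rw [freeWord_cons, SetLike.mem_coe, LinearMap.mem_ker, LinearMap.comp_apply,
        LinearMap.comp_apply, cop_ι_mul, hgen]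
  exact h hy

lemma exists_mem_freeSpan {l : List (Fin n)} {p : D.Alg} (hp : p ∈ D.wtSpan (wt l)) :
    ∃ y ∈ freeSpan K n l.length, D.proj y = p := by
  have h : D.wtSpan (wt l) ≤ (freeSpan K n l.length).map D.proj.toLinearMap := by
    rw [wtSpan, Submodule.span_le]
    rintro _ ⟨l', hl', rfl⟩
    refine ⟨freeWord K l', Submodule.subset_span ⟨l', ?_, rfl⟩, D.proj_freeWord l'⟩
    have := congrArg (fun β : Fin n → ℤ => ∑ j, β j) hl'
    simpa [sum_wt] using this
  exact h hp

/-- On a primitive element the antipode acts by `-1`. -/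
lemma antiCoeff_smul_rev {l : List (Fin n)} (hl : l ≠ [])
    (hinj : ∀ v ∈ D.lenSpan (Set.Ioo 0 l.length), v ∈ LinearMap.ker D.derPi → v = 0)
    {p : D.Alg} (hp : p ∈ D.wtSpan (wt l)) (hder : ∀ i, D.der 1 i p = 0) :
    D.antiCoeff (wt l) • D.rev p = -p := by
  obtain ⟨y, hy, rfl⟩ := D.exists_mem_freeSpan hp
  have hlen : l.length ≠ 0 := by simpa using hl
  have h := D.mul_anti_cop hlen hy
  have hone : D.anti 1 = 1 := by
    have := D.anti_word []
    rwa [wt_nil, antiCoeff_zero, one_smul, word_nil, rev_one] at this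
  rw [D.cop_eq_of_der_eq_zero hlen hinj hy hder, map_add, map_add, TensorProduct.map_tmul,
    TensorProduct.map_tmul, LinearMap.mul'_apply, LinearMap.mul'_apply, hone, one_mul,
    LinearMap.id_apply, LinearMap.id_apply, mul_one, D.anti_eq_smul_rev hp] at h
  exact eq_neg_of_add_eq_zero_left h

lemma antiCoeff_ne_zero (β : Fin n → ℤ) : D.antiCoeff β ≠ 0 :=
  mul_ne_zero (zpow_ne_zero _ (neg_ne_zero.mpr one_ne_zero)) (zpow_ne_zero _ D.q_ne_zero)

lemma antiCoeff_sq_smul {β : Fin n → ℤ} {p : D.Alg} (h : D.antiCoeff β • D.rev p = -p) :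
    D.antiCoeff β ^ 2 • p = p := by
  have h' := congrArg D.rev h
  rw [map_smul, rev_rev, map_neg] at h'
  rw [sq, mul_smul, h', smul_neg, h, neg_neg]

lemma der_neg_one_eq_zero {β : Fin n → ℤ} {p : D.Alg} (h : D.antiCoeff β • D.rev p = -p)
    {i : Fin n} (hder : D.der 1 i p = 0) : D.der (-1) i p = 0 := by
  have h' := congrArg (D.der 1 i) h
  rw [map_smul, map_neg, hder, neg_zero, smul_eq_zero_iff_right (D.antiCoeff_ne_zero β)] at h'
  rw [der_neg_one, h', map_zero, map_zero]

lemma e_pow_mul_e_mem (i j : Fin n) (t : ℕ) :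
    D.e i ^ t * D.e j ∈ LinearMap.range (LinearMap.mulRight K (D.e i ^ (t + 1 - D.N i j))) := by
  have hpow : ∀ (y : D.Alg) {k m : ℕ}, k ≤ m →
      y * D.e i ^ m ∈ LinearMap.range (LinearMap.mulRight K (D.e i ^ k)) := fun y k m hkm =>
    ⟨y * D.e i ^ (m - k), by
      rw [LinearMap.mulRight_apply, mul_assoc, ← pow_add, Nat.sub_add_cancel hkm]⟩
  rcases eq_or_ne i j with rfl | hij
  · simpa [← pow_succ] using hpow 1 (Nat.sub_le (t + 1) (D.N i i))
  induction t using Nat.strong_induction_on with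
  | _ t ih =>
    rcases lt_or_ge t (D.N i j) with ht | ht
    · simp [Nat.sub_eq_zero_of_le ht]
    · have h := congrArg (D.e i ^ (t - D.N i j) * ·) (D.serre i j hij)
      simp only [serreComb, mul_zero, Finset.sum_range_succ', D.c_zero, one_smul, pow_zero, mul_one,
        Nat.sub_zero, mul_add, ← mul_assoc, ← pow_add, Nat.sub_add_cancel ht] at h
      rw [eq_neg_of_add_eq_zero_right h, Finset.mul_sum]
      refine neg_mem (sum_mem fun s hs => ?_)
      rw [Finset.mem_range] at hs
      obtain ⟨z, hz⟩ := ih (t - (s + 1)) (by omega)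
      rw [LinearMap.mulRight_apply] at hz
      have hsplit : t - D.N i j + (D.N i j - (s + 1)) = t - (s + 1) := by omega
      rw [mul_smul_comm, ← mul_assoc, ← mul_assoc, ← pow_add, hsplit, ← hz, mul_assoc, ← pow_add]
      exact Submodule.smul_mem _ _ (hpow _ (by omega))

/-- Left multiplication by a high power of `e i` lands in the left ideal of `e i ^ m`. -/
lemma exists_e_pow_mul_mem (i : Fin n) (y : D.Alg) (m : ℕ) :
    ∃ N, D.e i ^ N * y ∈ LinearMap.range (LinearMap.mulRight K (D.e i ^ m)) := by
  have hmono : ∀ {y : D.Alg} {m N N' : ℕ}, N ≤ N' →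
      D.e i ^ N * y ∈ LinearMap.range (LinearMap.mulRight K (D.e i ^ m)) →
      D.e i ^ N' * y ∈ LinearMap.range (LinearMap.mulRight K (D.e i ^ m)) := by
    rintro y m N N' hN ⟨z, hz⟩
    refine ⟨D.e i ^ (N' - N) * z, ?_⟩
    rw [LinearMap.mulRight_apply] at hz ⊢
    rw [mul_assoc, hz, ← mul_assoc, ← pow_add, Nat.sub_add_cancel hN]
  have hy : y ∈ Submodule.span K (Set.range D.word) := by simp [D.span_range_word]
  induction hy using Submodule.span_induction with
  | mem x hx =>
    obtain ⟨l, rfl⟩ := hx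
    induction l with
    | nil => exact ⟨m, 1, by simp⟩
    | cons j l ih =>
      obtain ⟨N, z, hz⟩ := ih
      obtain ⟨z', hz'⟩ := D.e_pow_mul_e_mem i j (N + D.N i j)
      rw [LinearMap.mulRight_apply] at hz hz'
      refine ⟨N + D.N i j, z' * D.e i * z, ?_⟩
      have hN : N + D.N i j + 1 - D.N i j = N + 1 := by omega
      rw [LinearMap.mulRight_apply, word_cons, ← mul_assoc, ← hz', mul_assoc _ z, hz, hN, pow_succ']
      simp only [mul_assoc]
  | zero => exact ⟨0, by simp⟩
  | add x y _ _ hx hy =>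
    obtain ⟨N, hN⟩ := hx
    obtain ⟨N', hN'⟩ := hy
    refine ⟨max N N', ?_⟩
    rw [mul_add]
    exact add_mem (hmono (le_max_left _ _) hN) (hmono (le_max_right _ _) hN')
  | smul a x _ hx =>
    obtain ⟨N, hN⟩ := hx
    exact ⟨N, by rw [mul_smul_comm]; exact Submodule.smul_mem _ _ hN⟩

lemma kappa_of_mem_wtSpan (ε : ℤˣ) (i : Fin n) {β : Fin n → ℤ} {p : D.Alg}
    (hp : p ∈ D.wtSpan β) : D.kappa ε i p = D.q ^ (ε * D.form i β) • p := by
  have h : D.wtSpan β ≤ LinearMap.eqLocus (D.kappa ε i).toLinearMap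
      (D.q ^ (ε * D.form i β) • LinearMap.id) := by
    rw [wtSpan, Submodule.span_le]
    rintro _ ⟨l, rfl, rfl⟩
    exact D.kappa_word ε i l
  exact h hp

lemma der_e_pow_mul (ε : ℤˣ) (i : Fin n) {β : Fin n → ℤ} {p : D.Alg} (hp : p ∈ D.wtSpan β)
    (hder : D.der ε i p = 0) (N : ℕ) :
    D.der ε i (D.e i ^ (N + 1) * p) =
      (D.q ^ (ε * D.form i β) * ∑ t ∈ Finset.range (N + 1), (D.q ^ (ε * D.b i i)) ^ t) •
        (D.e i ^ N * p) := by
  induction N with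
  | zero => simp [der_e_mul, hder, D.kappa_of_mem_wtSpan ε i hp]
  | succ N ih =>
    rw [pow_succ', mul_assoc, der_e_mul, ih, if_pos rfl, map_mul, map_pow, scale_e,
      D.kappa_of_mem_wtSpan ε i hp, smul_pow, smul_mul_smul_comm, mul_smul_comm, ← mul_assoc,
      ← pow_succ', ← add_smul, Finset.sum_range_succ _ (N + 1)]
    congr 1
    ring

lemma geom_sum_ne_zero (i : Fin n) (N : ℕ) :
    ∑ t ∈ Finset.range (N + 1), (D.q ^ D.b i i) ^ t ≠ 0 := by
  intro h
  have hd := D.d_pos i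
  have hb := D.b_self i
  have h' := mul_geom_sum (D.q ^ D.b i i) (N + 1)
  rw [h, mul_zero, ← zpow_natCast, ← zpow_mul] at h'
  refine D.zpow_ne_one (D.b i i * ((N + 1 : ℕ) : ℤ)) (mul_ne_zero (by omega) (by simp; omega)) ?_
  exact (sub_eq_zero.mp h'.symm)

lemma geom_sum_inv {x : K} (hx : x ≠ 0) (N : ℕ) :
    x ^ N * ∑ t ∈ Finset.range (N + 1), x⁻¹ ^ t = ∑ t ∈ Finset.range (N + 1), x ^ t := by
  induction N with
  | zero => simp
  | succ N ih =>
    rw [Finset.sum_range_succ, mul_add, ← mul_pow, mul_inv_cancel₀ hx, one_pow, pow_succ',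
      mul_assoc,
      ih, geom_sum_succ (n := N + 1)]

lemma der_sub_der_mul_e (i : Fin n) (y : D.Alg) :
    D.der 1 i (y * D.e i) - D.der (-1) i (y * D.e i) =
      (D.q ^ D.b i i • D.der 1 i y - D.q ^ (-D.b i i) • D.der (-1) i y) * D.e i := by
  simp [der_mul, sub_mul]

/-- Elements of positive `α_i`-weight killed by both skew derivations are divisible by `e i`. -/
lemma exists_eq_mul_e {i : Fin n} {β : Fin n → ℤ} (hβ : 0 < D.form i β) {p : D.Alg}
    (hp : p ∈ D.wtSpan β) (h1 : D.der 1 i p = 0) (h2 : D.der (-1) i p = 0) :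
    ∃ y, p = y * D.e i := by
  obtain ⟨N, z, hz⟩ := D.exists_e_pow_mul_mem i p 1
  rw [LinearMap.mulRight_apply, pow_one] at hz
  induction N generalizing z with
  | zero => exact ⟨z, by simpa using hz.symm⟩
  | succ N ih =>
    have hG := D.der_sub_der_mul_e i z
    rw [hz, D.der_e_pow_mul 1 i hp h1, D.der_e_pow_mul (-1) i hp h2, ← sub_smul] at hG
    set a : K := _
    change a • _ = _ at hG
    have ha : a ≠ 0 := by
      have hq := zpow_ne_zero (D.b i i) D.q_ne_zero
      have hq' := zpow_ne_zero (D.form i β) D.q_ne_zero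
      have key : (D.q ^ D.b i i) ^ N * D.q ^ D.form i β * a =
          (D.q ^ (D.b i i * N + 2 * D.form i β) - 1) *
            ∑ t ∈ Finset.range (N + 1), (D.q ^ D.b i i) ^ t := by
        simp only [a, Units.val_neg, Units.val_one, one_mul, neg_mul, zpow_neg]
        rw [zpow_add₀ D.q_ne_zero, zpow_mul, zpow_natCast, mul_comm 2, zpow_mul, zpow_two,
          mul_sub, sub_mul, one_mul]
        congr 1
        · ring
        · rw [← geom_sum_inv hq N]
          field_simp
      have hd := D.d_pos i
      have hb := D.b_self i
      have hpos : 0 < D.b i i * N + 2 * D.form i β := by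
        have : 0 ≤ D.b i i * N := mul_nonneg (by omega) (by simp)
        omega
      intro h0
      rw [h0, mul_zero] at key
      exact mul_ne_zero (sub_ne_zero.mpr (D.zpow_ne_one _ hpos.ne')) (D.geom_sum_ne_zero i N)
        key.symm
    refine ih (a⁻¹ • (D.q ^ D.b i i • D.der 1 i z - D.q ^ (-D.b i i) • D.der (-1) i z)) ?_
    rw [smul_mul_assoc, ← hG, smul_smul, inv_mul_cancel₀ ha, one_smul]

lemma exists_der_pow_eq_zero (i : Fin n) (y : D.Alg) : ∃ M, (D.der 1 i ^ M) y = 0 := by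
  have hfree : ∀ k, ∀ y ∈ freeSpan K n k, (D.der 1 i ^ (k + 1)) (D.proj y) = 0 := by
    intro k
    induction k with
    | zero =>
      intro y hy
      have hset : {l : List (Fin n) | l.length = 0} = {[]} := by ext; simp
      rw [freeSpan, hset, Set.image_singleton, Submodule.mem_span_singleton] at hy
      obtain ⟨a, rfl⟩ := hy
      simp
    | succ k ih =>
      intro y hy
      rw [pow_succ, Module.End.mul_apply, ← proj_freeDer]
      exact ih _ (D.freeDer_mem_freeSpan 1 i hy)
  have hy : y ∈ Submodule.span K (Set.range D.word) := by simp [D.span_range_word]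
  induction hy using Submodule.span_induction with
  | mem x hx =>
    obtain ⟨l, rfl⟩ := hx
    exact ⟨l.length + 1, by rw [← proj_freeWord]; exact hfree _ _ (freeWord_mem_freeSpan l)⟩
  | zero => exact ⟨0, by simp⟩
  | add x y _ _ hx hy =>
    obtain ⟨M, hM⟩ := hx
    obtain ⟨M', hM'⟩ := hy
    refine ⟨max M M', ?_⟩
    rw [map_add, Module.End.pow_map_zero_of_le (le_max_left _ _) hM,
      Module.End.pow_map_zero_of_le (le_max_right _ _) hM', add_zero]
  | smul a x _ hx =>
    obtain ⟨M, hM⟩ := hx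
    exact ⟨M, by rw [map_smul, hM, smul_zero]⟩

lemma der_pow_mul_e (i : Fin n) (y : D.Alg) (k : ℕ) :
    (D.der 1 i ^ (k + 1)) (y * D.e i) =
      (D.q ^ D.b i i) ^ (k + 1) • ((D.der 1 i ^ (k + 1)) y * D.e i) +
        (∑ t ∈ Finset.range (k + 1), (D.q ^ D.b i i) ^ t) • (D.der 1 i ^ k) y := by
  induction k with
  | zero => simp [der_mul]
  | succ k ih =>
    rw [pow_succ' _ (k + 1), Module.End.mul_apply, ih, map_add, map_smul, map_smul, der_mul, der_e,
      if_pos rfl, mul_one, scale_e, ← Module.End.mul_apply, ← Module.End.mul_apply, ← pow_succ',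
      ← pow_succ', Units.val_one, one_mul, mul_smul_comm, smul_add, smul_smul, ← pow_succ,
      Finset.sum_range_succ _ (k + 1), add_smul, add_assoc, add_comm (_ • _) (_ • _)]

lemma eq_zero_of_der_mul_e {i : Fin n} {y : D.Alg} (h : D.der 1 i (y * D.e i) = 0) : y = 0 := by
  obtain ⟨M, hM⟩ := D.exists_der_pow_eq_zero i y
  induction M with
  | zero => simpa using hM
  | succ M ih =>
    refine ih ?_
    have h' := D.der_pow_mul_e i y M
    rw [hM, zero_mul, smul_zero, zero_add, pow_succ, Module.End.mul_apply, h, map_zero] at h'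
    exact (smul_eq_zero.mp h'.symm).resolve_left (D.geom_sum_ne_zero i M)

lemma eq_zero_of_form_pos {i : Fin n} {β : Fin n → ℤ} (hβ : 0 < D.form i β) {p : D.Alg}
    (hp : p ∈ D.wtSpan β) (h1 : D.der 1 i p = 0) (h2 : D.der (-1) i p = 0) : p = 0 := by
  obtain ⟨y, rfl⟩ := D.exists_eq_mul_e hβ hp h1 h2
  rw [D.eq_zero_of_der_mul_e h1, zero_mul]

lemma antiCoeff_sq_ne_one {l : List (Fin n)} (hl : l ≠ []) (h : ∀ i, D.form i (wt l) = 0) :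
    D.antiCoeff (wt l) ^ 2 ≠ 1 := by
  have hpos : 0 < ∑ j, D.d j * wt l j := by
    have hle : ∑ j, wt l j ≤ ∑ j, D.d j * wt l j := Finset.sum_le_sum fun j _ =>
      le_mul_of_one_le_left (wt_nonneg l j) (D.d_pos j)
    have := List.length_pos_iff.mpr hl
    rw [sum_wt] at hle
    omega
  have hdiv : (0 - 2 * ∑ j, D.d j * wt l j) / 2 = -∑ j, D.d j * wt l j := by omega
  simp only [antiCoeff, h, mul_zero, Finset.sum_const_zero]
  rw [hdiv, mul_pow, ← zpow_natCast, ← zpow_mul, mul_comm _ ((2 : ℕ) : ℤ), zpow_mul, zpow_natCast,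
    neg_one_sq, one_zpow, one_mul, ← zpow_natCast, ← zpow_mul]
  exact D.zpow_ne_one _ (by simp only [Nat.cast_ofNat]; omega)

/-- In affine type, an element without constant term killed by all skew derivations vanishes. -/
theorem eq_zero_of_der_eq_zero {r : Fin n → ℤ} (hr : ∀ i, 0 < r i)
    (hnull : ∀ j, ∑ i, r i * D.b i j = 0) {p : D.Alg} (hp : p ∈ D.lenSpan (Set.Ioi 0))
    (hder : ∀ i, D.der 1 i p = 0) : p = 0 := by
  have claim : ∀ m, ∀ l : List (Fin n), l.length = m → l ≠ [] → ∀ p ∈ D.wtSpan (wt l),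
      p ∈ LinearMap.ker D.derPi → p = 0 := by
    intro m
    induction m using Nat.strong_induction_on with
    | _ m ih =>
      rintro l rfl hl p hp hker
      have hinj : ∀ v ∈ D.lenSpan (Set.Ioo 0 l.length), v ∈ LinearMap.ker D.derPi → v = 0 :=
        fun v => D.eq_zero_of_mem_lenSpan_of_mem_ker fun l' hl' =>
          ih _ hl'.2 l' rfl (List.length_pos_iff.mp hl'.1)
      rw [mem_ker_derPi] at hker
      have hrev := D.antiCoeff_smul_rev hl hinj hp hker
      by_cases hform : ∃ i, 0 < D.form i (wt l)
      · obtain ⟨i, hi⟩ := hform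
        exact D.eq_zero_of_form_pos hi hp (hker i) (D.der_neg_one_eq_zero hrev (hker i))
      · push Not at hform
        have hsum : ∑ i, r i * D.form i (wt l) = 0 := by
          simp only [form, Finset.mul_sum]
          rw [Finset.sum_comm]
          simp only [← mul_assoc, ← Finset.sum_mul, hnull, zero_mul, Finset.sum_const_zero]
        have hzero : ∀ i, D.form i (wt l) = 0 := fun i =>
          (mul_eq_zero.mp ((Finset.sum_eq_zero_iff_of_nonpos fun i _ =>
            mul_nonpos_of_nonneg_of_nonpos (hr i).le (hform i)).mp hsum i
              (Finset.mem_univ i))).resolve_left (hr i).ne'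
        have hsq := D.antiCoeff_sq_smul hrev
        by_contra hne
        refine D.antiCoeff_sq_ne_one hl hzero (sub_eq_zero.mp ?_)
        refine (smul_eq_zero.mp ?_).resolve_right hne
        rw [sub_smul, hsq, one_smul, sub_self]
  exact D.eq_zero_of_mem_lenSpan_of_mem_ker
    (fun l hl => claim _ l rfl (List.length_pos_iff.mp hl)) hp (D.mem_ker_derPi.mpr hder)

end SerreDatum

section QuantumNumbers

variable {K : Type*} [Field K]

/-- The quantum integer `[m]` at the parameter `y`. -/
def qnum (y : K) (m : ℤ) : K := (y ^ m - y ^ (-m)) / (y - y⁻¹)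

lemma qnum_inv (y : K) (m : ℤ) : qnum y⁻¹ m = qnum y m := by
  rw [qnum, qnum, inv_zpow', inv_zpow', inv_inv, neg_neg, ← neg_sub (y ^ m), ← neg_sub y,
    neg_div_neg_eq]

lemma qnum_zero (y : K) : qnum y 0 = 0 := by simp [qnum]

lemma sub_inv_ne_zero {y : K} (hy0 : y ≠ 0) (hy : y ^ 2 ≠ 1) : y - y⁻¹ ≠ 0 := by
  contrapose! hy
  rw [sub_eq_zero] at hy
  rw [sq]
  nth_rw 2 [hy]
  exact mul_inv_cancel₀ hy0

lemma qnum_ne_zero {y : K} (hy0 : y ≠ 0) (hy : ∀ k : ℤ, k ≠ 0 → y ^ k ≠ 1) {m : ℤ} (hm : m ≠ 0) :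
    qnum y m ≠ 0 := by
  refine div_ne_zero (fun h => hy (m + m) (by omega) ?_)
    (sub_inv_ne_zero hy0 (by exact_mod_cast hy 2 two_ne_zero))
  rw [zpow_add₀ hy0]
  nth_rw 2 [sub_eq_zero.mp h]
  rw [← zpow_add₀ hy0, add_neg_cancel, zpow_zero]

lemma geom_sum_sq {y : K} (hy0 : y ≠ 0) (hy : y ^ 2 ≠ 1) (m : ℕ) :
    y * ∑ s ∈ Finset.range m, (y ^ 2) ^ s = y ^ m * qnum y m := by
  have h := sub_inv_ne_zero hy0 hy
  refine mul_left_cancel₀ h ?_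
  rw [qnum, mul_left_comm _ (y ^ m), mul_div_cancel₀ _ h, ← mul_assoc, zpow_neg, zpow_natCast,
    sub_mul, inv_mul_cancel₀ hy0, ← sq, mul_geom_sum, mul_sub,
    mul_inv_cancel₀ (pow_ne_zero m hy0), ← pow_mul, mul_comm 2, pow_mul, sq]

/-- The identity behind the compatibility of the Serre relation with the skew derivation `r_i`. -/
lemma serre_coeff_succ {y : K} (hy0 : y ≠ 0) (hy : y ^ 2 ≠ 1) {c : ℕ → K} {N t : ℕ} (ht : t < N)
    (hc : c (t + 1) * qnum y (t + 1) = -(c t * qnum y (N - t))) :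
    c (t + 1) * ∑ s ∈ Finset.range (t + 1), (y ^ 2) ^ s +
      c t * (y ^ (1 - N : ℤ) * (y ^ 2) ^ t) * ∑ s ∈ Finset.range (N - t), (y ^ 2) ^ s = 0 := by
  have h1 := geom_sum_sq hy0 hy (t + 1)
  have h2 := geom_sum_sq hy0 hy (N - t)
  obtain ⟨k, rfl⟩ := Nat.exists_eq_add_of_lt ht
  have hk : t + k + 1 - t = k + 1 := by omega
  rw [hk] at h2 ⊢
  have hk' : (((t + k + 1 : ℕ) : ℤ) - t) = ((k + 1 : ℕ) : ℤ) := by push_cast; ring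
  rw [hk'] at hc
  refine mul_left_cancel₀ hy0 ?_
  have hpow : y ^ (1 - ((t + k + 1 : ℕ) : ℤ)) * (y ^ 2) ^ t * y ^ (k + 1) = y ^ (t + 1) := by
    rw [← pow_mul, ← zpow_natCast, ← zpow_natCast, ← zpow_natCast, ← zpow_add₀ hy0,
      ← zpow_add₀ hy0]
    congr 1
    push_cast
    ring
  push_cast at hc h1 h2 hpow ⊢
  linear_combination c (t + 1) * h1 + c t * (y ^ (1 - (t + k + 1) : ℤ) * (y ^ 2) ^ t) * h2 +
    y ^ (t + 1) * hc + c t * qnum y (k + 1) * hpow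

/-- The vanishing behind the compatibility of the Serre relation with the skew derivation `r_j`. -/
lemma serre_coeff_sum {y : K} (hy0 : y ≠ 0) (hy : ∀ k : ℤ, k ≠ 0 → y ^ k ≠ 1) {c : ℕ → K} {N : ℕ}
    (hN : N ≠ 0) (hc : ∀ t < N, c (t + 1) * qnum y (t + 1) = -(c t * qnum y (N - t))) :
    ∑ s ∈ Finset.range (N + 1), c s * (y ^ (1 - N : ℤ)) ^ s = 0 := by
  have key : ∀ t ≤ N, (∑ s ∈ Finset.range (t + 1), c s * (y ^ (1 - N : ℤ)) ^ s) * qnum y N =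
      c t * y ^ (-(N * t) : ℤ) * qnum y (N - t) := by
    intro t
    induction t with
    | zero => simp
    | succ t ih =>
      intro ht
      have h := sub_inv_ne_zero hy0 (by exact_mod_cast hy 2 two_ne_zero)
      have hnum : y ^ (-(N * t) : ℤ) * qnum y (t + 1) + y ^ (-(N * (t + 1)) : ℤ) *
          qnum y (N - (t + 1)) = y ^ ((1 - N) * (t + 1) : ℤ) * qnum y N := by
        refine mul_left_cancel₀ h ?_
        simp only [mul_add _ (_ * _), mul_left_comm (y - y⁻¹), qnum, mul_div_cancel₀ _ h, mul_sub,
          ← zpow_add₀ hy0]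
        ring_nf
      rw [Finset.sum_range_succ, add_mul, ih (by omega), ← zpow_natCast, ← zpow_mul]
      have hct := hc t (by omega)
      push_cast
      linear_combination y ^ (-(N * t) : ℤ) * hct - c (t + 1) * hnum
  have h := key N le_rfl
  rw [sub_self, qnum_zero, mul_zero] at h
  exact (mul_eq_zero.mp h).resolve_right (qnum_ne_zero hy0 hy (by exact_mod_cast hN))

end QuantumNumbers

lemma qvar_ne_zero : qvar ≠ 0 := RatFunc.X_ne_zero

lemma qvar_zpow_ne_one (k : ℤ) (hk : k ≠ 0) : qvar ^ k ≠ 1 := by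
  have hnat : ∀ m : ℕ, m ≠ 0 → qvar ^ m ≠ 1 := by
    intro m hm h
    rw [qvar, ← RatFunc.algebraMap_X, ← map_pow, ← map_one (algebraMap (Polynomial ℚ) Kq)] at h
    have := congrArg Polynomial.natDegree (RatFunc.algebraMap_injective ℚ h)
    rw [Polynomial.natDegree_X_pow, Polynomial.natDegree_one] at this
    exact hm this
  intro h
  obtain ⟨m, rfl | rfl⟩ := k.eq_nat_or_neg
  · exact hnat m (by simpa using hk) (by simpa using h)
  · exact hnat m (by simpa using hk) (by simpa using h)

lemma qi_ne_zero (d : Fin n → ℕ) (i : Fin n) : qi d i ≠ 0 := pow_ne_zero _ qvar_ne_zero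

lemma qi_zpow (d : Fin n → ℕ) (i : Fin n) (k : ℤ) : qi d i ^ k = qvar ^ (d i * k) := by
  rw [qi, ← zpow_natCast, ← zpow_mul]

lemma qi_zpow_ne_one {d : Fin n → ℕ} {i : Fin n} (hd : 0 < d i) (k : ℤ) (hk : k ≠ 0) :
    qi d i ^ k ≠ 1 := by
  rw [qi_zpow]
  exact qvar_zpow_ne_one _ (mul_ne_zero (by exact_mod_cast hd.ne') hk)

lemma qint_eq_qnum (d : Fin n → ℕ) (i : Fin n) (m : ℤ) : qint d i m = qnum (qi d i) m := rfl

section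

variable {d : Fin n → ℕ} {i : Fin n}

lemma qfact_ne_zero (hd : 0 < d i) (m : ℕ) : qfact d i m ≠ 0 := by
  induction m with
  | zero => exact one_ne_zero
  | succ m ih =>
    exact mul_ne_zero ih (qnum_ne_zero (qi_ne_zero d i) (qi_zpow_ne_one hd) (by omega))

lemma qbinom_zero (hd : 0 < d i) (m : ℕ) : qbinom d i m 0 = 1 := by
  rw [qbinom, Nat.sub_zero, qfact, one_mul, div_self (qfact_ne_zero hd m)]

lemma qbinom_symm {m s : ℕ} (h : s ≤ m) : qbinom d i m (m - s) = qbinom d i m s := by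
  rw [qbinom, qbinom, Nat.sub_sub_self h, mul_comm]

lemma qbinom_succ_mul (hd : 0 < d i) {m t : ℕ} (h : t < m) :
    qbinom d i m (t + 1) * qint d i (t + 1) = qbinom d i m t * qint d i (m - t) := by
  obtain ⟨k, rfl⟩ := Nat.exists_eq_add_of_lt h
  have h1 : t + k + 1 - (t + 1) = k := by omega
  have h2 : t + k + 1 - t = k + 1 := by omega
  have h3 : (((t + k + 1 : ℕ) : ℤ) - t) = k + 1 := by push_cast; ring
  have hq : ∀ k : ℕ, qint d i (k + 1) ≠ 0 := fun k =>
    qnum_ne_zero (qi_ne_zero d i) (qi_zpow_ne_one hd) (by omega)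
  have := hq t
  have := hq k
  have := qfact_ne_zero hd t
  have := qfact_ne_zero hd k
  rw [qbinom, qbinom, h1, h2, h3]
  simp only [qfact]
  field_simp

end

variable {a : Fin n → Fin n → ℤ} {d r : Fin n → ℕ}

/-- The coefficients of the quantum Serre relations. -/
def serreCoeff (a : Fin n → Fin n → ℤ) (d : Fin n → ℕ) (i j : Fin n) (s : ℕ) : Kq :=
  (-1 : Kq) ^ s * qbinom d i (1 - a i j).toNat s

lemma serreCoeff_succ_mul (h : CartanData n a d r) {i j : Fin n} (ε : ℤˣ) {t : ℕ}
    (ht : t < (1 - a i j).toNat) :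
    serreCoeff a d i j (t + 1) * qnum (qvar ^ (ε * d i : ℤ)) (t + 1) =
      -(serreCoeff a d i j t * qnum (qvar ^ (ε * d i : ℤ)) ((1 - a i j).toNat - t)) := by
  have hε : ∀ m, qnum (qvar ^ (ε * d i : ℤ)) m = qint d i m := by
    intro m
    rcases Int.units_eq_one_or ε with rfl | rfl
    · rw [qint_eq_qnum, qi, Units.val_one, one_mul, zpow_natCast]
    · rw [qint_eq_qnum, qi, Units.val_neg, Units.val_one, neg_one_mul, zpow_neg, qnum_inv,
        zpow_natCast]
  rw [hε, hε, serreCoeff, serreCoeff, mul_assoc, mul_assoc, qbinom_succ_mul (h.d_pos i) ht]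
  ring

lemma CartanData.zpow_b_self (h : CartanData n a d r) (ε : ℤˣ) (i : Fin n) :
    qvar ^ (ε * (d i * a i i) : ℤ) = (qvar ^ (ε * d i : ℤ)) ^ 2 := by
  rw [h.diag, ← mul_assoc, zpow_mul]
  rfl

lemma CartanData.zpow_b (h : CartanData n a d r) (ε : ℤˣ) {i j : Fin n} (hij : i ≠ j) :
    qvar ^ (ε * (d i * a i j) : ℤ) =
      (qvar ^ (ε * d i : ℤ)) ^ (1 - ((1 - a i j).toNat : ℤ)) := by
  have := h.offdiag i j hij
  have h1 : 1 - ((1 - a i j).toNat : ℤ) = a i j := by omega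
  rw [h1, ← mul_assoc, zpow_mul]

lemma CartanData.zpow_ne_one (h : CartanData n a d r) (ε : ℤˣ) (i : Fin n) (k : ℤ) (hk : k ≠ 0) :
    (qvar ^ (ε * d i : ℤ)) ^ k ≠ 1 := by
  rw [← zpow_mul]
  exact qvar_zpow_ne_one _
    (mul_ne_zero (mul_ne_zero ε.ne_zero (by exact_mod_cast (h.d_pos i).ne')) hk)

/-- The datum defining the positive part of the quantum affine algebra. -/
def CartanData.serreDatum (h : CartanData n a d r) : SerreDatum Kq n where
  q := qvar
  d i := d i
  b i j := d i * a i j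
  N i j := (1 - a i j).toNat
  c := serreCoeff a d
  q_ne_zero := qvar_ne_zero
  zpow_ne_one := qvar_zpow_ne_one
  d_pos i := by exact_mod_cast h.d_pos i
  b_self i := by rw [h.diag, mul_comm]
  b_symm := h.symmetrizable
  c_zero i j := by rw [serreCoeff, pow_zero, one_mul, qbinom_zero (h.d_pos i)]
  c_symm i j s hs := by
    rw [serreCoeff, serreCoeff, qbinom_symm hs, ← mul_assoc]
    congr 1
    refine mul_right_cancel₀ (pow_ne_zero s (neg_ne_zero.mpr (one_ne_zero (α := Kq)))) ?_
    rw [← pow_add, Nat.sub_add_cancel hs, mul_assoc, ← mul_pow, neg_mul_neg, one_mul, one_pow,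
      mul_one]
  c_succ i j hij ε t ht := by
    rw [h.zpow_b_self, h.zpow_b ε hij]
    exact serre_coeff_succ (zpow_ne_zero _ qvar_ne_zero)
      (by exact_mod_cast h.zpow_ne_one ε i 2 two_ne_zero) ht
      (serreCoeff_succ_mul h ε ht)
  c_sum i j hij ε := by
    rw [h.zpow_b ε hij]
    have := h.offdiag i j hij
    exact serre_coeff_sum (zpow_ne_zero _ qvar_ne_zero) (h.zpow_ne_one ε i) (by omega)
      fun t ht => serreCoeff_succ_mul h ε ht

namespace SerreDatum

variable {K : Type*} [Field K] (D : SerreDatum K n)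

lemma scale_zero (y : D.Alg) : D.scale 0 y = y := by
  have : (D.scale 0).toLinearMap = LinearMap.id := D.hom_ext fun l => by simp [scale_word]
  exact DFunLike.congr_fun this y

lemma scale_der (c : Fin n → ℤ) (ε : ℤˣ) (i : Fin n) (y : D.Alg) :
    D.scale c (D.der ε i y) = D.q ^ (-c i) • D.der ε i (D.scale c y) := by
  have : (D.scale c).toLinearMap ∘ₗ D.der ε i =
      D.q ^ (-c i) • (D.der ε i ∘ₗ (D.scale c).toLinearMap) := by
    refine D.hom_ext fun l => ?_
    induction l with
    | nil => simp
    | cons m l ih =>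
      simp only [LinearMap.comp_apply, LinearMap.smul_apply, AlgHom.toLinearMap_apply, word_cons,
        der_e_mul, map_add, map_mul, scale_e, smul_mul_assoc, map_smul] at ih ⊢
      rw [ih, mul_smul_comm, smul_add, smul_add, smul_comm]
      congr 1
      split_ifs with him
      · rw [him, smul_smul, ← zpow_add₀ D.q_ne_zero, neg_add_cancel, zpow_zero, one_smul,
          kappa, scale_scale_comm]
      · simp
  exact DFunLike.congr_fun this y

/-- Left multiplication by `e i`, the action of `E_i`. -/
def opE (i : Fin n) : Module.End K D.Alg := Algebra.lmul K D.Alg (D.e i)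

/-- The action of `K_i ^ ε` on the Verma-type module with highest weight `t`. -/
def opK (t : Kˣ) (ε : ℤˣ) (i : Fin n) : Module.End K D.Alg :=
  ((t ^ (ε : ℤ) : Kˣ) : K) • (D.kappa ε i).toLinearMap

/-- The action of `F_i` on the Verma-type module with highest weight `t`. -/
def opF (t : Kˣ) (i : Fin n) : Module.End K D.Alg :=
  (D.q ^ D.d i - (D.q ^ D.d i)⁻¹)⁻¹ • ((t⁻¹ : Kˣ) • D.der (-1) i - t • D.der 1 i)

variable (t : Kˣ)

@[simp] lemma opE_apply (i : Fin n) (y : D.Alg) : D.opE i y = D.e i * y := rfl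

lemma opK_apply (ε : ℤˣ) (i : Fin n) (y : D.Alg) :
    D.opK t ε i y = ((t ^ (ε : ℤ) : Kˣ) : K) • D.kappa ε i y := rfl

lemma opF_apply (i : Fin n) (y : D.Alg) : D.opF t i y =
    (D.q ^ D.d i - (D.q ^ D.d i)⁻¹)⁻¹ • ((t⁻¹ : Kˣ) • D.der (-1) i y - t • D.der 1 i y) := rfl

lemma opF_one (i : Fin n) : D.opF t i 1 = 0 := by simp [opF_apply]

lemma opK_mul_opK_neg (ε : ℤˣ) (i : Fin n) : D.opK t ε i * D.opK t (-ε) i = 1 := by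
  ext1 y
  have : (fun j => (ε : ℤ) * D.b i j) + (fun j => ((-ε : ℤˣ) : ℤ) * D.b i j) = 0 := by
    funext j
    simp
  rw [Module.End.mul_apply, opK_apply, opK_apply, map_smul, scale_scale, this, scale_zero,
    smul_smul, ← Units.val_mul, ← zpow_add]
  simp

lemma opK_mul_opK_comm (i j : Fin n) :
    D.opK t 1 i * D.opK t 1 j = D.opK t 1 j * D.opK t 1 i := by
  ext1 y
  simp only [Module.End.mul_apply, opK_apply, map_smul]
  rw [kappa, kappa, scale_scale_comm]

lemma opK_mul_opE (ε : ℤˣ) (i j : Fin n) :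
    D.opK t ε i * D.opE j = D.q ^ (ε * D.b i j) • (D.opE j * D.opK t ε i) := by
  ext1 y
  simp only [Module.End.mul_apply, LinearMap.smul_apply, opK_apply, opE_apply, map_mul, scale_e,
    smul_mul_assoc, mul_smul_comm]
  rw [smul_comm]

lemma opK_mul_opF (ε : ℤˣ) (i j : Fin n) :
    D.opK t ε i * D.opF t j = D.q ^ ((-ε : ℤˣ) * D.b i j) • (D.opF t j * D.opK t ε i) := by
  ext1 y
  simp only [Module.End.mul_apply, LinearMap.smul_apply, opK_apply, opF_apply, map_smul, map_sub,
    Units.smul_def, scale_der, smul_sub, smul_smul, Units.val_neg, neg_mul]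
  congr 2 <;> ring

lemma opE_mul_opF (i j : Fin n) : D.opE i * D.opF t j - D.opF t j * D.opE i =
    if i = j then (D.q ^ D.d i - (D.q ^ D.d i)⁻¹)⁻¹ • (D.opK t 1 i - D.opK t (-1) i) else 0 := by
  ext1 y
  rcases eq_or_ne i j with rfl | hij
  · simp only [LinearMap.sub_apply, Module.End.mul_apply, opE_apply, opF_apply, der_e_mul,
      if_pos, LinearMap.smul_apply, opK_apply, mul_smul_comm, ← smul_sub, mul_sub, Units.smul_def,
      Units.val_one, Units.val_neg, zpow_one, zpow_neg, smul_add]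
    congr 1
    abel
  · simp only [LinearMap.sub_apply, Module.End.mul_apply, opE_apply, opF_apply, der_e_mul,
      if_neg hij, if_neg hij.symm, mul_smul_comm, mul_sub, Units.smul_def, add_zero, sub_self,
      LinearMap.zero_apply]

lemma opF_mul_opE (i k : Fin n) : D.opF t i * D.opE k = D.opE k * D.opF t i +
    (if k = i then -(D.q ^ D.d k - (D.q ^ D.d k)⁻¹)⁻¹ • D.opK t 1 k else 0) +
    (if k = i then (D.q ^ D.d k - (D.q ^ D.d k)⁻¹)⁻¹ • D.opK t (-1) k else 0) := by
  rw [← sub_eq_iff_eq_add'.mpr (sub_eq_iff_eq_add.mp (D.opE_mul_opF t k i))]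
  split_ifs <;> module

lemma serreComb_opF (i j : Fin n) (h : i ≠ j) :
    serreComb (D.c i j) (D.N i j) (D.opF t i) (D.opF t j) = 0 := by
  have comm : ∀ k, serreComb (D.c i j) (D.N i j) (D.opF t i) (D.opF t j) * D.opE k =
      D.opE k * serreComb (D.c i j) (D.N i j) (D.opF t i) (D.opF t j) := by
    intro k
    have hi := D.opF_mul_opE t i k
    have hj := D.opF_mul_opE t j k
    have hK : ∀ (a : K) (ε : ℤˣ) (m : Fin n), (a • D.opK t ε k) * D.opF t m =
        D.q ^ ((-ε : ℤˣ) * D.b k m) • (D.opF t m * (a • D.opK t ε k)) := by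
      intro a ε m
      rw [smul_mul_assoc, opK_mul_opF, mul_smul_comm, smul_comm]
    by_cases hki : k = i
    · subst hki
      simp only [if_true] at hi
      rw [if_neg h, if_neg h, add_zero, add_zero] at hj
      exact serreComb_mul_comm_of_skew_left hi hj (hK _ _ _) (hK _ _ _) (hK _ _ _) (hK _ _ _)
        (D.c_succ k j h _) (D.c_succ k j h _)
    · rw [if_neg hki, if_neg hki, add_zero, add_zero] at hi
      by_cases hkj : k = j
      · subst hkj
        simp only [if_true] at hj
        have hs := D.c_sum i k h
        rw [D.b_symm] at hs
        exact serreComb_mul_comm_of_skew_right hi hj (hK _ _ _) (hK _ _ _) (hs _) (hs _)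
      · rw [if_neg hkj, if_neg hkj] at hj
        have hs := D.c_sum i j h 1
        exact serreComb_mul_comm_of_skew_right hi hj (by simp) (by simp) hs hs
  refine D.hom_ext fun l => ?_
  induction l with
  | nil =>
    rw [serreComb, LinearMap.sum_apply]
    refine Finset.sum_eq_zero fun s _ => ?_
    rcases s with _ | s
    · simp [opF_one]
    · simp [pow_succ, opF_one]
  | cons k l ih =>
    have := DFunLike.congr_fun (comm k) (D.word l)
    rw [Module.End.mul_apply, Module.End.mul_apply, ih] at this
    simpa using this

lemma prod_opK_pow (r : Fin n → ℕ) (l : List (Fin n)) (y : D.Alg) :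
    (l.map fun i => D.opK t 1 i ^ r i).prod y =
      ((t : K) ^ (l.map r).sum) •
        D.scale (fun j => (l.map fun i => (r i : ℤ) * D.b i j).sum) y := by
  have hpow : ∀ (i : Fin n) (m : ℕ) (y : D.Alg), (D.opK t 1 i ^ m) y =
      ((t : K) ^ m) • D.scale (fun j => (m : ℤ) * D.b i j) y := by
    intro i m
    induction m with
    | zero =>
      intro y
      have : (fun j => ((0 : ℕ) : ℤ) * D.b i j) = 0 := funext fun j => by simp
      rw [pow_zero, pow_zero, one_smul, this, scale_zero, Module.End.one_apply]
    | succ m ih =>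
      intro y
      rw [pow_succ, Module.End.mul_apply, ih, opK_apply, map_smul, scale_scale, smul_smul]
      congr 1
      · simp [pow_succ]
      · congr 2
        funext j
        simp
        ring
  induction l with
  | nil =>
    simp only [List.map_nil, List.sum_nil, List.prod_nil, pow_zero, one_smul, Module.End.one_apply]
    exact (D.scale_zero y).symm
  | cons i l ih =>
    rw [List.map_cons, List.prod_cons, Module.End.mul_apply, ih, hpow, map_smul, scale_scale,
      smul_smul, List.map_cons, List.sum_cons, pow_add, mul_comm]
    rfl

/-- If `p` commutes with the `F_i` in the Verma-type modules of two generic highest weights, then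
all its skew derivatives vanish. -/
lemma der_eq_zero_of_opF_eq_zero {i : Fin n} {p : D.Alg} (h0 : D.opF 1 i p = 0)
    (ht : t ^ 2 ≠ 1) (h1 : D.opF t i p = 0) : D.der 1 i p = 0 := by
  have hw : (D.q ^ D.d i - (D.q ^ D.d i)⁻¹)⁻¹ ≠ 0 :=
    inv_ne_zero (sub_inv_ne_zero (zpow_ne_zero _ D.q_ne_zero) (by
      rw [← zpow_natCast, ← zpow_mul]
      exact D.zpow_ne_one _ (mul_ne_zero (D.d_pos i).ne' two_ne_zero)))
  rw [opF_apply, smul_eq_zero_iff_right hw, sub_eq_zero] at h0 h1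
  rw [inv_one, one_smul, one_smul] at h0
  rw [h0, inv_smul_eq_iff, smul_smul, ← sq, Units.smul_def, eq_comm, ← sub_eq_zero] at h1
  nth_rw 2 [← one_smul K (D.der 1 i p)] at h1
  rw [← sub_smul, smul_eq_zero] at h1
  exact h1.resolve_left fun h => ht (Units.ext (sub_eq_zero.mp h))

end SerreDatum

namespace CartanData

variable {a : Fin n → Fin n → ℤ} {d r : Fin n → ℕ} (h : CartanData n a d r)

/-- The action of the generators of `U_q` on the Verma-type module with highest weight `s ^ 2`. -/
def opGen (s : Kqˣ) : Gen n → Module.End Kq h.serreDatum.Alg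
  | Gen.E i => h.serreDatum.opE i
  | Gen.F i => h.serreDatum.opF (s ^ 2) i
  | Gen.K i => h.serreDatum.opK (s ^ 2) 1 i
  | Gen.Kinv i => h.serreDatum.opK (s ^ 2) (-1) i
  | Gen.g => algebraMap Kq _ ((s ^ ((List.finRange n).map r).sum : Kqˣ) : Kq)
  | Gen.ginv => algebraMap Kq _ (((s ^ ((List.finRange n).map r).sum)⁻¹ : Kqˣ) : Kq)

/-- The action of the free algebra on the Verma-type module with highest weight `s ^ 2`. -/
def freeRep (s : Kqˣ) : FA n →ₐ[Kq] Module.End Kq h.serreDatum.Alg :=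
  FreeAlgebra.lift Kq (h.opGen s)

lemma freeRep_ι (s : Kqˣ) (x : Gen n) : h.freeRep s (ι x) = h.opGen s x :=
  FreeAlgebra.lift_ι_apply _ _

lemma serreDatum_q_zpow (i : Fin n) (ε m : ℤ) :
    h.serreDatum.q ^ (ε * (d i * m)) = qi d i ^ (ε * m) := by
  rw [qi_zpow]
  congr 1
  ring

lemma opGen_gsq (s : Kqˣ) : h.opGen s Gen.g * h.opGen s Gen.g =
    ((List.finRange n).map fun i => h.opGen s (Gen.K i) ^ r i).prod := by
  ext1 y
  have hb : (fun j => ((List.finRange n).map fun i => (r i : ℤ) * h.serreDatum.b i j).sum) = 0 := by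
    funext j
    rw [← Fin.sum_univ_def, Pi.zero_apply, ← h.null j]
    exact Finset.sum_congr rfl fun i _ => (mul_assoc _ _ _).symm
  refine Eq.trans ?_ (h.serreDatum.prod_opK_pow (s ^ 2) r (List.finRange n) y).symm
  rw [hb, SerreDatum.scale_zero, opGen, ← map_mul, ← Units.val_mul, ← sq, pow_right_comm,
    ← Units.val_pow_eq_pow_val]
  rfl

lemma freeRep_eq_of_rel (s : Kqˣ) ⦃x y : FA n⦄ (hxy : QRel a d r x y) :
    h.freeRep s x = h.freeRep s y := by
  induction hxy with
  | KKinv i =>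
    rw [map_mul, map_one, freeRep_ι, freeRep_ι]
    exact h.serreDatum.opK_mul_opK_neg _ 1 i
  | KinvK i =>
    rw [map_mul, map_one, freeRep_ι, freeRep_ι]
    have := h.serreDatum.opK_mul_opK_neg (s ^ 2) (-1) i
    rwa [neg_neg] at this
  | gginv =>
    rw [map_mul, map_one, freeRep_ι, freeRep_ι, opGen, opGen, ← map_mul, Units.mul_inv,
      map_one]
  | ginvg =>
    rw [map_mul, map_one, freeRep_ι, freeRep_ι, opGen, opGen, ← map_mul, Units.inv_mul,
      map_one]
  | gcomm x =>
    rw [map_mul, map_mul, freeRep_ι, freeRep_ι, opGen]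
    exact Algebra.commutes _ _
  | gsq =>
    rw [map_mul, map_list_prod, List.map_map, freeRep_ι, opGen_gsq]
    congr 2
    funext i
    rw [Function.comp_apply, map_pow, freeRep_ι]
  | KK i j =>
    simp only [map_mul, freeRep_ι]
    exact h.serreDatum.opK_mul_opK_comm _ i j
  | KE i j =>
    simp only [map_smul, map_mul, freeRep_ι]
    refine (h.serreDatum.opK_mul_opE _ 1 i j).trans (congrArg (· • _) ?_)
    exact (h.serreDatum_q_zpow i 1 (a i j)).trans (by rw [one_mul])
  | KF i j =>
    simp only [map_smul, map_mul, freeRep_ι]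
    refine (h.serreDatum.opK_mul_opF _ 1 i j).trans (congrArg (· • _) ?_)
    exact (h.serreDatum_q_zpow i (-1) (a i j)).trans (by rw [neg_one_mul])
  | EF i j =>
    rw [map_sub, map_mul, map_mul, freeRep_ι, freeRep_ι]
    refine (h.serreDatum.opE_mul_opF _ i j).trans ?_
    have hq : h.serreDatum.q ^ h.serreDatum.d i = qi d i := zpow_natCast _ _
    rw [hq]
    split_ifs
    · rw [map_smul, map_sub, freeRep_ι, freeRep_ι]
      rfl
    · rw [map_zero]
  | serreEE i j hij =>
    refine (map_serreComb (h.freeRep s) (serreCoeff a d i j) _ _ _).trans ?_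
    rw [map_zero, freeRep_ι, freeRep_ι]
    refine (map_serreComb (Algebra.lmul Kq h.serreDatum.Alg) _ _ _ _).symm.trans ?_
    exact (congrArg _ (h.serreDatum.serre i j hij)).trans (map_zero _)
  | serreFF i j hij =>
    refine (map_serreComb (h.freeRep s) (serreCoeff a d i j) _ _ _).trans ?_
    rw [map_zero, freeRep_ι, freeRep_ι]
    exact h.serreDatum.serreComb_opF _ i j hij

/-- The Verma-type module of `U_q` with highest weight `s ^ 2`. -/
def rep (s : Kqˣ) : Uq a d r →ₐ[Kq] Module.End Kq h.serreDatum.Alg :=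
  RingQuot.liftAlgHom Kq ⟨h.freeRep s, h.freeRep_eq_of_rel s⟩

lemma rep_gen (s : Kqˣ) (x : Gen n) : h.rep s (gen a d r x) = h.opGen s x :=
  (RingQuot.liftAlgHom_mkAlgHom_apply Kq _ _ _).trans (h.freeRep_ι s x)

/-- The map from the algebra defined by the Serre relations to `U_q`. -/
def fromSerre : h.serreDatum.Alg →ₐ[Kq] Uq a d r :=
  h.serreDatum.lift (fun i => gen a d r (Gen.E i)) fun i j hij =>
    (map_serreComb (RingQuot.mkAlgHom Kq (QRel a d r)) _ _ _ _).symm.trans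
      ((RingQuot.mkAlgHom_rel Kq (QRel.serreEE i j hij)).trans (map_zero _))

lemma fromSerre_e (i : Fin n) : h.fromSerre (h.serreDatum.e i) = gen a d r (Gen.E i) :=
  SerreDatum.lift_e _ _ _ _

lemma fromSerre_word (l : List (Fin n)) :
    h.fromSerre (h.serreDatum.word l) = (l.map fun j => gen a d r (Gen.E j)).prod := by
  induction l with
  | nil => simp
  | cons i l ih =>
    rw [SerreDatum.word_cons, map_mul, ih, fromSerre_e, List.map_cons, List.prod_cons]

lemma rep_fromSerre (s : Kqˣ) (p : h.serreDatum.Alg) : h.rep s (h.fromSerre p) 1 = p := by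
  have : LinearMap.applyₗ 1 ∘ₗ (h.rep s).toLinearMap ∘ₗ h.fromSerre.toLinearMap =
      LinearMap.id := by
    refine h.serreDatum.hom_ext fun l => ?_
    change h.rep s (h.fromSerre (h.serreDatum.word l)) 1 = h.serreDatum.word l
    rw [fromSerre_word]
    induction l with
    | nil => simp
    | cons i l ih =>
      rw [List.map_cons, List.prod_cons, map_mul, Module.End.mul_apply, ih, rep_gen,
        SerreDatum.word_cons]
      rfl
  exact DFunLike.congr_fun this p

lemma exists_fromSerre_eq {x : Uq a d r} (hx : x ∈ AugSpan a d r) :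
    ∃ p ∈ h.serreDatum.lenSpan (Set.Ioi 0), h.fromSerre p = x := by
  suffices AugSpan a d r ≤ (h.serreDatum.lenSpan (Set.Ioi 0)).map h.fromSerre.toLinearMap from
    this hx
  refine Submodule.span_le.mpr ?_
  rintro _ ⟨l, hl, rfl⟩
  exact ⟨_, h.serreDatum.word_mem_lenSpan (List.length_pos_iff.mpr hl), h.fromSerre_word l⟩

lemma opF_eq_zero_of_comm (s : Kqˣ) {p : h.serreDatum.Alg} {k : Fin n}
    (hp : h.fromSerre p * gen a d r (Gen.F k) = gen a d r (Gen.F k) * h.fromSerre p) :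
    h.serreDatum.opF (s ^ 2) k p = 0 := by
  have := DFunLike.congr_fun (congrArg (h.rep s) hp) 1
  rw [map_mul, map_mul, Module.End.mul_apply, Module.End.mul_apply, rep_fromSerre, rep_gen] at this
  refine this.symm.trans ?_
  rw [opGen, SerreDatum.opF_one, map_zero]

end CartanData

/-- If `x ∈ U⁺` has zero constant term and commutes with all `F_k`, then `x = 0`. -/
theorem commutes_with_F_eq_zero {n : ℕ} (a : Fin n → Fin n → ℤ)
    (d r : Fin n → ℕ) (hC : CartanData n a d r)
    (x : Uq a d r) (hx : x ∈ AugSpan a d r)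
    (h : ∀ k : Fin n, x * gen a d r (Gen.F k) = gen a d r (Gen.F k) * x) :
    x = 0 := by
  obtain ⟨p, hp, rfl⟩ := hC.exists_fromSerre_eq hx
  suffices p = 0 by rw [this, map_zero]
  refine hC.serreDatum.eq_zero_of_der_eq_zero (r := fun i => r i)
    (fun i => by exact_mod_cast hC.r_pos i)
    (fun j => (Finset.sum_congr rfl fun i _ => (mul_assoc _ _ _).symm).trans (hC.null j)) hp
    fun k => ?_
  have h0 := hC.opF_eq_zero_of_comm 1 (h k)
  rw [one_pow] at h0
  refine hC.serreDatum.der_eq_zero_of_opF_eq_zero _ h0 (fun ht => ?_)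
    (hC.opF_eq_zero_of_comm (Units.mk0 qvar qvar_ne_zero) (h k))
  refine qvar_zpow_ne_one 4 (by norm_num) ?_
  rw [← pow_mul] at ht
  simpa using congrArg Units.val ht

end
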